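/- Let q = 2^s with q > 2. The ring of invariants of O_5(F_q) on its 5-dimensional defining representation equals the subalgebra A generated by {ξ_0, ξ_1, ξ_2, ξ_3, e_1, e_2}; moreover A[ξ_1^{−1}] = F_q[ξ_0, ξ_1, ξ_2, ξ_3, e_1][ξ_1^{−1}], and ξ_1 is a prime element of A. -/

import Mathlib

open MvPolynomial

/-- Variable index set for `S_2[z] = F_q[y_1,y_2,x_2,x_1,z]`:
`none` is `z`, `some (inl j)` is `y_j`, `some (inr j)` is `x_j`. -/
abbrev OIdx2 := Option (Fin 2 ⊕ Fin 2)

/-- The action of an invertible linear map `g` of `V = ι → F` on the polynomial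
ring on `V`, so that `eval v (act g f) = eval (g v) f`. -/
noncomputable def act {F : Type*} [Field F] {ι : Type*} [Fintype ι] [DecidableEq ι]
    (g : (ι → F) ≃ₗ[F] (ι → F)) : MvPolynomial ι F →ₐ[F] MvPolynomial ι F :=
  MvPolynomial.aeval fun i => ∑ j, MvPolynomial.C (g (Pi.single j 1) i) * MvPolynomial.X j

/-- The quadratic form `ξ_0 = z^2 + x_1 y_1 + x_2 y_2`. -/
noncomputable def xiZ (F : Type*) [Field F] : MvPolynomial OIdx2 F :=
  X none ^ 2 + ∑ j : Fin 2, X (some (Sum.inr j)) * X (some (Sum.inl j))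

/-- `ξ_i = Σ_j (x_j y_j^{q^i} + y_j x_j^{q^i})` for `i ≥ 1`. -/
noncomputable def xiG (q : ℕ) (F : Type*) [Field F] (i : ℕ) : MvPolynomial OIdx2 F :=
  ∑ j : Fin 2, (X (some (Sum.inr j)) * X (some (Sum.inl j)) ^ q ^ i
    + X (some (Sum.inl j)) * X (some (Sum.inr j)) ^ q ^ i)

/-- `ξ̄_0 = x_1 y_1 + x_2 y_2`. -/
noncomputable def xiB (F : Type*) [Field F] : MvPolynomial OIdx2 F :=
  ∑ j : Fin 2, X (some (Sum.inr j)) * X (some (Sum.inl j))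

/-- `u_2 = ξ_3 ξ_1^q + ξ_2^{q+1} + ξ_1^{q^2+1}`. -/
noncomputable def u2 (q : ℕ) (F : Type*) [Field F] : MvPolynomial OIdx2 F :=
  xiG q F 3 * xiG q F 1 ^ q + xiG q F 2 ^ (q + 1) + xiG q F 1 ^ (q ^ 2 + 1)

/-- The product `Π_{v ∈ F_q^4} (t + ℓ_v)` over all linear forms in
`x_1,x_2,y_2,y_1`; its coefficient of `t^{q^{4-i}}` is the Dickson invariant
`d_{i,2}` of `GL_4(F_q)`. -/
noncomputable def dickP (F : Type*) [Field F] [Fintype F] :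
    Polynomial (MvPolynomial OIdx2 F) :=
  ∏ c : (Fin 2 ⊕ Fin 2) → F,
    (Polynomial.X + Polynomial.C (∑ i, MvPolynomial.C (c i) * X (some i)))

universe u

theorem algebraicIndependent_of_isAlgebraic {R A ι κ : Type*} [Field R] [CommRing A] [IsDomain A]
    [Algebra R A] [Fintype ι] [Fintype κ] {x : ι → A} {y : κ → A}
    (hx : IsTranscendenceBasis R x) (hc : Fintype.card κ = Fintype.card ι)
    (halg : ∀ i, IsAlgebraic (Algebra.adjoin R (Set.range y)) (x i)) :
    AlgebraicIndependent R y := by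
  have := hx.isAlgebraic_iff.2 halg
  obtain ⟨t, ht, hb⟩ := exists_isTranscendenceBasis_subset (R := R) (Set.range y)
  have hfin : t.Finite := (Set.finite_range y).subset ht
  have hcard : t.ncard = Fintype.card ι := by
    have h1 := hx.lift_cardinalMk_eq_trdeg
    have h2 := hb.lift_cardinalMk_eq_trdeg
    have h3 : Cardinal.toNat (Cardinal.mk t) = Cardinal.toNat (Cardinal.mk ι) := by
      have := congrArg Cardinal.toNat h1
      have := congrArg Cardinal.toNat h2
      simp_all
    rw [← Nat.card_coe_set_eq, Nat.card, h3]
    simp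
  have hle : (Set.range y).ncard ≤ Fintype.card κ := by
    rw [← Set.image_univ]
    refine (Set.ncard_image_le).trans ?_
    simp [Set.ncard_univ]
  have hteq : t = Set.range y := Set.eq_of_subset_of_ncard_le ht (by omega) (Set.finite_range y)
  have hinj : Function.Injective y := by
    have : (y '' Set.univ).ncard = (Set.univ : Set κ).ncard := by
      rw [Set.image_univ, ← hteq, hcard, Set.ncard_univ, Nat.card_eq_fintype_card, hc]
    exact Set.injOn_univ.1 (Set.injOn_of_ncard_image_eq this)
  subst hteq
  exact ((isTranscendenceBasis_subtype_range hinj).1 hb).1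

/-- A polynomial whose square has degree at most two and no constant term is a linear form. -/
theorem MvPolynomial.eq_sum_of_sq {F σ : Type*} [Field F] [Fintype σ] {p : MvPolynomial σ F}
    (hdeg : (p ^ 2).totalDegree ≤ 2) (h0 : constantCoeff (p ^ 2) = 0) :
    ∃ c : σ → F, p = ∑ j, C (c j) * X j := by
  classical
  rcases eq_or_ne p 0 with rfl | hp
  · exact ⟨0, by simp⟩
  have hd : p.totalDegree ≤ 1 := by
    rw [sq, totalDegree_mul_of_isDomain hp hp] at hdeg
    omega
  have h0' : coeff 0 p = 0 := by
    rw [map_pow] at h0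
    simpa [constantCoeff_eq] using pow_eq_zero_iff (two_ne_zero) |>.1 h0
  refine ⟨fun j => coeff (Finsupp.single j 1) p, ?_⟩
  ext m
  rw [coeff_sum]
  simp only [coeff_C_mul, coeff_X]
  rcases Nat.lt_or_ge 1 m.degree with hm | hm
  · rw [coeff_eq_zero_of_totalDegree_lt (hd.trans_lt hm),
      Finset.sum_eq_zero]
    intro j _
    rw [if_neg, mul_zero]
    rintro rfl
    simp at hm
  · by_cases hm0 : m = 0
    · subst hm0
      simp [h0']
    · have h1 : m.degree = 1 := le_antisymm hm (Nat.one_le_iff_ne_zero.2 (mt (Finsupp.degree_eq_zero_iff m).1 hm0))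
      obtain ⟨i, rfl⟩ : ∃ i, Finsupp.single i 1 = m := by
        have h2 : (Finsupp.toMultiset m).card = 1 := by rw [Finsupp.card_toMultiset]; exact h1
        obtain ⟨i, hi⟩ := Multiset.card_eq_one.1 h2
        exact ⟨i, by rw [← Finsupp.toMultiset_toFinsupp m, hi, Multiset.toFinsupp_singleton]⟩
      simp [Finsupp.single_left_inj]

theorem mem_range_of_isIntegral_of_mul_eq {R S : Type*} [CommRing R] [IsDomain R]
    [IsIntegrallyClosed R] [CommRing S] [IsDomain S] [Algebra R S] [FaithfulSMul R S]
    {y : S} (hy : IsIntegral R y) {a b : R} (hb : b ≠ 0)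
    (h : algebraMap R S b * y = algebraMap R S a) : ∃ c, algebraMap R S c = y := by
  let ψ : FractionRing R →ₐ[R] FractionRing S :=
    IsFractionRing.liftAlgHom (g := Algebra.ofId R (FractionRing S))
      (FaithfulSMul.algebraMap_injective R (FractionRing S))
  let w : FractionRing R := algebraMap R _ a / algebraMap R _ b
  have hb' : algebraMap R (FractionRing S) b ≠ 0 := by
    simpa using hb
  have hw : ψ w = algebraMap S _ y := by
    rw [map_div₀, AlgHom.commutes, AlgHom.commutes, div_eq_iff hb',
      IsScalarTower.algebraMap_apply R S (FractionRing S) a, ← h, map_mul, mul_comm,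
      ← IsScalarTower.algebraMap_apply]
  have hwi : IsIntegral R w := by
    rw [← isIntegral_algHom_iff ψ ψ.toRingHom.injective, hw]
    exact hy.algebraMap
  obtain ⟨c, hc⟩ := IsIntegrallyClosed.isIntegral_iff.1 hwi
  refine ⟨c, IsFractionRing.injective S (FractionRing S) ?_⟩
  rw [← hw, ← hc, AlgHom.commutes, ← IsScalarTower.algebraMap_apply]

theorem pfaffian_relation {R : Type*} [CommRing R] [CharP R 2] (a b c d : ℕ → R) (B : ℕ → ℕ → R)
    (hB : ∀ i j, B i j = a i * b j + b i * a j + c i * d j + d i * c j) :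
    (B 0 3 * B 1 2 + B 0 2 * B 1 3 + B 0 1 * B 2 3) * a 4
    + (B 0 1 * B 2 4 + B 0 2 * B 1 4 + B 0 4 * B 1 2) * a 3
    + (B 0 1 * B 3 4 + B 0 3 * B 1 4 + B 0 4 * B 1 3) * a 2
    + (B 0 2 * B 3 4 + B 0 3 * B 2 4 + B 0 4 * B 2 3) * a 1
    + (B 1 4 * B 2 3 + B 1 3 * B 2 4 + B 1 2 * B 3 4) * a 0 = 0 := by
  simp only [hB, ← CharTwo.sub_eq_add]
  have h2 : (2 : R) = 0 := CharTwo.two_eq_zero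
  ring_nf
  have h4 : (4 : R) = 0 := by linear_combination 2 * h2
  have h6 : (6 : R) = 0 := by linear_combination 3 * h2
  simp [h2, h4, h6]

theorem add_pow_two_pow_pow {R : Type*} [CommRing R] [CharP R 2] {s q : ℕ} (hq : q = 2 ^ s)
    (a b : R) (k : ℕ) : (a + b) ^ q ^ k = a ^ q ^ k + b ^ q ^ k := by
  subst hq
  rw [← pow_mul]
  exact add_pow_char_pow a b 2 _

section

variable {F : Type*} [Field F]

theorem xiG_pow [CharP F 2] {s q : ℕ} (hq : q = 2 ^ s) (k i : ℕ) :
    xiG q F k ^ q ^ i =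
      X (some (Sum.inr 0)) ^ q ^ i * X (some (Sum.inl 0)) ^ q ^ (i + k)
      + X (some (Sum.inl 0)) ^ q ^ i * X (some (Sum.inr 0)) ^ q ^ (i + k)
      + X (some (Sum.inr 1)) ^ q ^ i * X (some (Sum.inl 1)) ^ q ^ (i + k)
      + X (some (Sum.inl 1)) ^ q ^ i * X (some (Sum.inr 1)) ^ q ^ (i + k) := by
  simp only [xiG, Fin.sum_univ_two, add_pow_two_pow_pow hq, mul_pow, ← pow_mul, ← pow_add,
    add_comm k i, add_assoc]

theorem u2_mul_relation [CharP F 2] {s q : ℕ} (hq : q = 2 ^ s) (t : Fin 2 ⊕ Fin 2) :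
    u2 q F * X (some t) ^ q ^ 4
    + (xiG q F 1 * xiG q F 2 ^ q ^ 2 + xiG q F 2 * xiG q F 3 ^ q + xiG q F 4 * xiG q F 1 ^ q)
      * X (some t) ^ q ^ 3
    + (xiG q F 1 * xiG q F 1 ^ q ^ 3 + xiG q F 3 * xiG q F 3 ^ q + xiG q F 4 * xiG q F 2 ^ q)
      * X (some t) ^ q ^ 2
    + (xiG q F 2 * xiG q F 1 ^ q ^ 3 + xiG q F 3 * xiG q F 2 ^ q ^ 2
        + xiG q F 4 * xiG q F 1 ^ q ^ 2) * X (some t) ^ q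
    + u2 q F ^ q * X (some t) = 0 := by
  let v (t : Fin 2 ⊕ Fin 2) (i : ℕ) : MvPolynomial OIdx2 F := X (some t) ^ q ^ i
  let B (i j : ℕ) : MvPolynomial OIdx2 F :=
    v (.inr 0) i * v (.inl 0) j + v (.inl 0) i * v (.inr 0) j
      + v (.inr 1) i * v (.inl 1) j + v (.inl 1) i * v (.inr 1) j
  have key : ∀ i k, xiG q F k ^ q ^ i = B i (i + k) := fun i k => xiG_pow hq k i
  have k1 : ∀ k, xiG q F k ^ q = B 1 (1 + k) := fun k => by rw [← key 1 k, pow_one]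
  have k0 : ∀ k, xiG q F k = B 0 k := fun k => by
    have := key 0 k
    rwa [pow_zero, pow_one, zero_add] at this
  have hu : u2 q F = B 0 3 * B 1 2 + B 0 2 * B 1 3 + B 0 1 * B 2 3 := by
    rw [u2, pow_add, pow_add, k1, k1, key, pow_one, pow_one, k0, k0, k0]
    ring
  have huq : u2 q F ^ q = B 1 4 * B 2 3 + B 1 3 * B 2 4 + B 1 2 * B 3 4 := by
    have hf : ∀ a b : MvPolynomial OIdx2 F, (a + b) ^ q = a ^ q + b ^ q := fun a b => by
      simpa using add_pow_two_pow_pow hq a b 1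
    have e2 : (xiG q F 1 ^ q) ^ q = xiG q F 1 ^ q ^ 2 := by rw [← pow_mul, sq]
    have e3 : (xiG q F 2 ^ (q + 1)) ^ q = xiG q F 2 ^ q ^ 2 * xiG q F 2 ^ q := by
      rw [← pow_mul, ← pow_add]; congr 1; ring
    have e4 : (xiG q F 1 ^ (q ^ 2 + 1)) ^ q = xiG q F 1 ^ q ^ 3 * xiG q F 1 ^ q := by
      rw [← pow_mul, ← pow_add]; congr 1; ring
    rw [u2, hf, hf, mul_pow, e2, e3, e4, k1, k1, k1, key, key, key]
    ring
  have main : ∀ a b c d : ℕ → MvPolynomial OIdx2 F,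
      (∀ i j, B i j = a i * b j + b i * a j + c i * d j + d i * c j) →
      (∀ i, a i = X (some t) ^ q ^ i) → _ := fun a b c d h h' => by
    have h1 := pfaffian_relation a b c d B h
    rw [h', h', h', h', h', ← hu, ← huq, pow_zero, pow_one, pow_one] at h1
    exact h1
  rw [huq, k1, k1, k1, key, key, key, k0, k0, k0, k0, ← huq]
  rcases t with t | t <;> fin_cases t
  · exact main (v (.inl 0)) (v (.inr 0)) (v (.inl 1)) (v (.inr 1))
      (fun i j => by simp only [B]; ring) (fun i => rfl)
  · exact main (v (.inl 1)) (v (.inr 1)) (v (.inl 0)) (v (.inr 0))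
      (fun i j => by simp only [B]; ring) (fun i => rfl)
  · exact main (v (.inr 0)) (v (.inl 0)) (v (.inl 1)) (v (.inr 1))
      (fun i j => by simp only [B]; ring) (fun i => rfl)
  · exact main (v (.inr 1)) (v (.inl 1)) (v (.inl 0)) (v (.inr 0))
      (fun i j => by simp only [B]; ring) (fun i => rfl)

theorem xiG_one_ne_zero {q : ℕ} (h : 1 < q) : xiG q F 1 ≠ 0 := by
  intro h0
  have h1 := congrArg (aeval (fun i : OIdx2 =>
    (if i = some (.inr 0) then Polynomial.X else if i = some (.inl 0) then 1 else 0 :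
      Polynomial F))) h0
  simp [xiG] at h1
  have h2 := congrArg (fun p => Polynomial.coeff p 1) h1
  simp [Polynomial.coeff_X_pow, h.ne] at h2

/-- A point over a field at which `ξ_1` vanishes and whose coordinates have transcendence
degree four. -/
theorem exists_generic_zero {F : Type u} [Field F] [CharP F 2] {s q : ℕ} (hs : 2 ≤ s)
    (hq : q = 2 ^ s) :
    ∃ (D : Type u) (_ : Field D) (_ : Algebra F D) (x : Fin 4 → D)
      (φ : MvPolynomial OIdx2 F →ₐ[F] D), IsTranscendenceBasis F x ∧ (∀ i, ∃ j, x i = φ (X j)) ∧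
        φ (xiG q F 1) = 0 ∧ φ (xiG q F 2) ≠ 0 := by
  have hq4 : 4 ≤ q := by
    rw [hq]; exact Nat.pow_le_pow_right (n := 2) two_pos hs
  let T := MvPolynomial (Fin 4) F
  let D := AlgebraicClosure (FractionRing T)
  let ι : T →ₐ[F] D := IsScalarTower.toAlgHom F T D
  have hinj : Function.Injective ι := by
    change Function.Injective (algebraMap T D)
    rw [IsScalarTower.algebraMap_eq T (FractionRing T) D]
    exact (algebraMap (FractionRing T) D).injective.comp (IsFractionRing.injective T _)
  have : CharP D 2 := charP_of_injective_algebraMap (algebraMap F D).injective 2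
  let x : Fin 4 → D := fun i => ι (X i)
  have hx : IsTranscendenceBasis F x := by
    have : FaithfulSMul T D := (faithfulSMul_iff_algebraMap_injective T D).2 hinj
    have : Algebra.IsAlgebraic T (FractionRing T) :=
      IsLocalization.isAlgebraic _ (nonZeroDivisors T)
    have : Algebra.IsAlgebraic T D :=
      Algebra.IsAlgebraic.trans T (FractionRing T) D
    exact (IsTranscendenceBasis.mvPolynomial (Fin 4) F).algebraMap_comp
  have hx2 : x 2 ≠ 0 := hx.1.ne_zero 2
  let c (k : ℕ) : D := x 0 * x 1 ^ q ^ k + x 1 * x 0 ^ q ^ k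
  obtain ⟨y, hy⟩ : ∃ y : D, x 2 * y ^ q + x 2 ^ q * y + c 1 = 0 := by
    let p : Polynomial D := Polynomial.C (x 2) * Polynomial.X ^ q +
      (Polynomial.C (x 2 ^ q) * Polynomial.X + Polynomial.C (c 1))
    have hp : p.degree ≠ 0 := by
      have h1 : p.degree = q := by
        have h2 : (Polynomial.C (x 2) * Polynomial.X ^ q : Polynomial D).degree = q := 
          Polynomial.degree_C_mul_X_pow q hx2
        rw [Polynomial.degree_add_eq_left_of_degree_lt, h2]
        rw [h2]
        refine lt_of_le_of_lt Polynomial.degree_linear_le ?_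
        exact_mod_cast (by omega : 1 < q)
      rw [h1]
      exact_mod_cast (by omega : q ≠ 0)
    obtain ⟨y, hy⟩ := IsAlgClosed.exists_root p hp
    exact ⟨y, by simpa [p, Polynomial.IsRoot, add_assoc] using hy⟩
  let φ : MvPolynomial OIdx2 F →ₐ[F] D := aeval fun i => match i with
    | none => x 3
    | some (.inr 0) => x 0
    | some (.inl 0) => x 1
    | some (.inr 1) => x 2
    | some (.inl 1) => y
  have hφ : ∀ k, φ (xiG q F k) = c k + (x 2 * y ^ q ^ k + y * x 2 ^ q ^ k) := fun k => by
    simp [xiG, φ, c]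
  refine ⟨D, inferInstance, inferInstance, x, φ, hx, ?_, ?_, ?_⟩
  · intro i
    fin_cases i
    · exact ⟨some (.inr 0), by simp [φ]⟩
    · exact ⟨some (.inl 0), by simp [φ]⟩
    · exact ⟨some (.inr 1), by simp [φ]⟩
    · exact ⟨none, by simp [φ]⟩
  · rw [hφ, pow_one]
    linear_combination hy
  · intro h0
    rw [hφ] at h0
    have hy' : x 2 ^ q * y ^ q ^ 2 + x 2 ^ q ^ 2 * y ^ q + c 1 ^ q = 0 := by
      have h1 := congrArg (· ^ q ^ 1) hy
      simp only [add_pow_two_pow_pow hq, mul_pow] at h1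
      rw [zero_pow (by simp; omega), pow_one, ← pow_mul, ← pow_mul, ← sq] at h1
      exact h1
    obtain ⟨r, rfl⟩ : ∃ r, q = r + 1 := ⟨q - 1, by omega⟩
    obtain ⟨m, hm⟩ : ∃ m, (r + 1) ^ 2 = m + 2 := ⟨(r + 1) ^ 2 - 2, by 
      have : 4 ^ 2 ≤ (r + 1) ^ 2 := Nat.pow_le_pow_left hq4 2
      omega⟩
    have h2 : (2 : D) = 0 := CharTwo.two_eq_zero
    have h3 : c 2 * x 2 ^ r + c 1 * x 2 ^ (m + 1) + c 1 ^ (r + 1) = 0 := by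
      rw [hm] at h0 hy'
      have e : x 2 ^ (m + 2) = x 2 ^ (m + 1) * x 2 := pow_succ _ _
      have e1 : x 2 ^ (r + 1) = x 2 ^ r * x 2 := pow_succ _ _
      rw [e] at hy' h0
      rw [e1] at hy hy'
      linear_combination x 2 ^ r * h0 + hy' + x 2 ^ (m + 1) * hy - (x 2 ^ r * x 2 * y ^ (m + 2)
        + x 2 ^ (m + 1) * x 2 * y ^ (r + 1) + y * x 2 ^ (m + 1) * x 2 * x 2 ^ r) * h2
    let P (k : ℕ) : T := X 0 * X 1 ^ (r + 1) ^ k + X 1 * X 0 ^ (r + 1) ^ k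
    have h4 : P 2 * X 2 ^ r + P 1 * X 2 ^ (m + 1) + P 1 ^ (r + 1) = 0 := by
      apply hinj
      simpa [P, c, x] using h3
    have h5 := congrArg (aeval (![Polynomial.X, 1, 0, 0] : Fin 4 → Polynomial F)) h4
    have hr : r ≠ 0 := by omega
    simp [P, hr] at h5
    have h6 := congrArg (fun p => Polynomial.coeff p 1) h5
    simp [Polynomial.coeff_X_pow, hr] at h6

end

section

variable {F : Type*} [Field F]

theorem u2_ne_zero [CharP F 2] {s q : ℕ} (hs : 2 ≤ s) (hq : q = 2 ^ s) : u2 q F ≠ 0 := by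
  obtain ⟨D, _, _, x, φ, -, -, h1, h2⟩ := exists_generic_zero (F := F) hs hq
  intro h0
  have h3 := congrArg φ h0
  have hq0 : q ≠ 0 := by rw [hq]; positivity
  rw [u2, map_add, map_add, map_mul, map_pow, map_pow, map_pow, h1, map_zero, zero_pow hq0,
    zero_pow (by omega)] at h3
  simp [h2] at h3

theorem eval_dickP [Fintype F] [CharP F 2] (c : Fin 2 ⊕ Fin 2 → F) :
    (dickP F).eval (∑ i, C (c i) * X (some i)) = 0 := by
  rw [dickP, Polynomial.eval_prod]
  exact Finset.prod_eq_zero (Finset.mem_univ c) (by simp [CharTwo.add_self_eq_zero])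

theorem linearForm_injective :
    Function.Injective fun c : Fin 2 ⊕ Fin 2 → F =>
      (∑ i, C (c i) * X (some i) : MvPolynomial OIdx2 F) := by
  intro c c' h
  funext i
  have := congrArg (coeff (Finsupp.single (some i) 1)) h
  simpa [coeff_sum, coeff_C_mul, coeff_X, Finsupp.single_left_inj, -Fintype.sum_sum_type]
    using this

theorem dickP_monic [Fintype F] : (dickP F).Monic :=
  Polynomial.monic_prod_of_monic _ _ fun _ _ => Polynomial.monic_X_add_C _

theorem dickP_natDegree [Fintype F] {q : ℕ} (hF : Fintype.card F = q) :
    (dickP F).natDegree = q ^ 4 := by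
  rw [dickP, Polynomial.natDegree_prod_of_monic _ _ fun _ _ => Polynomial.monic_X_add_C _]
  simp only [Polynomial.natDegree_X_add_C]
  simp [hF]

theorem u2_mul_dickP [Fintype F] [CharP F 2] {s q : ℕ} (hs : 2 ≤ s) (hq : q = 2 ^ s)
    (hF : Fintype.card F = q) :
    Polynomial.C (u2 q F) * Polynomial.X ^ q ^ 4
    + Polynomial.C (xiG q F 1 * xiG q F 2 ^ q ^ 2 + xiG q F 2 * xiG q F 3 ^ q
        + xiG q F 4 * xiG q F 1 ^ q) * Polynomial.X ^ q ^ 3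
    + Polynomial.C (xiG q F 1 * xiG q F 1 ^ q ^ 3 + xiG q F 3 * xiG q F 3 ^ q
        + xiG q F 4 * xiG q F 2 ^ q) * Polynomial.X ^ q ^ 2
    + Polynomial.C (xiG q F 2 * xiG q F 1 ^ q ^ 3 + xiG q F 3 * xiG q F 2 ^ q ^ 2
        + xiG q F 4 * xiG q F 1 ^ q ^ 2) * Polynomial.X ^ q
    + Polynomial.C (u2 q F ^ q) * Polynomial.X = Polynomial.C (u2 q F) * dickP F := by
  classical
  have hq1 : 1 < q := by
    rw [hq]; exact Nat.one_lt_two_pow (by omega)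
  have l1 : q < q ^ 4 := by simpa using Nat.pow_lt_pow_right hq1 (by norm_num : 1 < 4)
  have l2 : q ^ 2 < q ^ 4 := Nat.pow_lt_pow_right hq1 (by norm_num)
  have l3 : q ^ 3 < q ^ 4 := Nat.pow_lt_pow_right hq1 (by norm_num)
  have hcard : (Finset.univ.image fun c : Fin 2 ⊕ Fin 2 → F =>
      (∑ i, C (c i) * X (some i) : MvPolynomial OIdx2 F)).card = q ^ 4 := by
    rw [Finset.card_image_of_injective _ linearForm_injective]
    simp [hF]
  refine Polynomial.eq_of_degree_sub_lt_of_eval_finset_eq (Finset.univ.image fun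
    c : Fin 2 ⊕ Fin 2 → F => (∑ i, C (c i) * X (some i) : MvPolynomial OIdx2 F)) ?_ ?_
  · rw [hcard, Polynomial.degree_lt_iff_coeff_zero]
    intro m hm
    have hm' : q ^ 4 ≤ m := hm
    simp only [Polynomial.coeff_sub, Polynomial.coeff_add, Polynomial.coeff_C_mul,
      Polynomial.coeff_X_pow, Polynomial.coeff_X]
    rw [if_neg (by omega : ¬ m = q ^ 3), if_neg (by omega : ¬ m = q ^ 2),
      if_neg (by omega : ¬ m = q), if_neg (by omega : ¬ 1 = m)]
    rcases hm'.eq_or_lt with rfl | hlt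
    · rw [← dickP_natDegree hF, dickP_monic.coeff_natDegree]
      simp
    · rw [if_neg (by omega), Polynomial.coeff_eq_zero_of_natDegree_lt (by rwa [dickP_natDegree hF])]
      simp
  · intro y hy
    obtain ⟨c, -, rfl⟩ := Finset.mem_image.1 hy
    rw [Polynomial.eval_mul, eval_dickP, mul_zero]
    have hpow : ∀ k, (∑ i, C (c i) * X (some i) : MvPolynomial OIdx2 F) ^ q ^ k =
        ∑ i, C (c i) * X (some i) ^ q ^ k := fun k => by
      have hck : ∀ i, c i ^ q ^ k = c i := fun i => by rw [← hF]; exact FiniteField.pow_card_pow k _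
      rw [hq, ← pow_mul, sum_pow_char_pow, pow_mul, ← hq]
      simp [mul_pow, ← C_pow, hck]
    have hpow1 := hpow 1
    rw [pow_one] at hpow1
    simp only [Polynomial.eval_add, Polynomial.eval_mul, Polynomial.eval_C, Polynomial.eval_pow,
      Polynomial.eval_X, hpow, hpow1, Finset.mul_sum, ← Finset.sum_add_distrib]
    refine Finset.sum_eq_zero fun i _ => ?_
    linear_combination C (c i) * u2_mul_relation (F := F) hq i

theorem dickson_coeffs [Fintype F] [CharP F 2] {s q : ℕ} (hs : 2 ≤ s) (hq : q = 2 ^ s)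
    (hF : Fintype.card F = q) :
    dickP F = Polynomial.X ^ q ^ 4 + Polynomial.C ((dickP F).coeff (q ^ 3)) * Polynomial.X ^ q ^ 3
      + Polynomial.C ((dickP F).coeff (q ^ 2)) * Polynomial.X ^ q ^ 2
      + Polynomial.C ((dickP F).coeff q) * Polynomial.X ^ q
      + Polynomial.C (u2 q F ^ (q - 1)) * Polynomial.X ∧
    u2 q F * (dickP F).coeff (q ^ 3) =
      xiG q F 1 * xiG q F 2 ^ q ^ 2 + xiG q F 2 * xiG q F 3 ^ q + xiG q F 4 * xiG q F 1 ^ q := by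
  have hq1 : 1 < q := by
    rw [hq]; exact Nat.one_lt_two_pow (by omega)
  have l1 : q < q ^ 2 := by simpa using Nat.pow_lt_pow_right hq1 (by norm_num : 1 < 2)
  have l2 : q ^ 2 < q ^ 3 := Nat.pow_lt_pow_right hq1 (by norm_num)
  have l3 : q ^ 3 < q ^ 4 := Nat.pow_lt_pow_right hq1 (by norm_num)
  have hP := u2_mul_dickP hs hq hF
  have hc : ∀ m, _ := fun m => congrArg (fun p => Polynomial.coeff p m) hP
  simp only [Polynomial.coeff_add, Polynomial.coeff_C_mul,
      Polynomial.coeff_X_pow, Polynomial.coeff_X] at hc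
  have c3 := hc (q ^ 3)
  have c2 := hc (q ^ 2)
  have c1 := hc q
  rw [if_neg (by omega), if_pos rfl, if_neg (by omega), if_neg (by omega), if_neg (by omega)] at c3
  rw [if_neg (by omega), if_neg (by omega), if_pos rfl, if_neg (by omega), if_neg (by omega)] at c2
  rw [if_neg (by omega), if_neg (by omega), if_neg (by omega), if_pos rfl, if_neg (by omega)] at c1
  simp only [mul_zero, mul_one, zero_add, add_zero] at c1 c2 c3
  refine ⟨?_, c3.symm⟩
  have hu : u2 q F ≠ 0 := u2_ne_zero hs hq
  have hu' : u2 q F ^ q = u2 q F * u2 q F ^ (q - 1) := by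
    rw [← pow_succ']; congr 1; omega
  apply mul_left_cancel₀ (Polynomial.C_ne_zero.2 hu)
  rw [← hP, c3, c2, c1, hu']
  simp only [Polynomial.C_mul]
  ring

theorem dickson_root [Fintype F] [CharP F 2] {s q : ℕ} (hs : 2 ≤ s) (hq : q = 2 ^ s)
    (hF : Fintype.card F = q) (t : Fin 2 ⊕ Fin 2) :
    (X (some t) : MvPolynomial OIdx2 F) ^ q ^ 4 + (dickP F).coeff (q ^ 3) * X (some t) ^ q ^ 3
      + (dickP F).coeff (q ^ 2) * X (some t) ^ q ^ 2 + (dickP F).coeff q * X (some t) ^ q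
      + u2 q F ^ (q - 1) * X (some t) = 0 := by
  classical
  have h := eval_dickP (F := F) (Pi.single t 1)
  have ht : (∑ i, C ((Pi.single t 1 : Fin 2 ⊕ Fin 2 → F) i) * X (some i) : MvPolynomial OIdx2 F)
      = X (some t) := by
    rw [Finset.sum_eq_single t] <;> simp +contextual
  rw [ht, (dickson_coeffs hs hq hF).1] at h
  simpa using h

/-- Pairing the Dickson relation with the Frobenius twists of the generic vector. -/
theorem dickson_xiG [Fintype F] [CharP F 2] {s q : ℕ} (hs : 2 ≤ s) (hq : q = 2 ^ s)
    (hF : Fintype.card F = q) :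
    (xiG q F 3 ^ q + (dickP F).coeff (q ^ 3) * xiG q F 2 ^ q
      + (dickP F).coeff (q ^ 2) * xiG q F 1 ^ q + u2 q F ^ (q - 1) * xiG q F 1 = 0) ∧
    (xiG q F 2 ^ q ^ 2 + (dickP F).coeff (q ^ 3) * xiG q F 1 ^ q ^ 2
      + (dickP F).coeff q * xiG q F 1 ^ q + u2 q F ^ (q - 1) * xiG q F 2 = 0) ∧
    (xiG q F 1 ^ q ^ 3 + (dickP F).coeff (q ^ 2) * xiG q F 1 ^ q ^ 2
      + (dickP F).coeff q * xiG q F 2 ^ q + u2 q F ^ (q - 1) * xiG q F 3 = 0) := by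
  have r := dickson_root (F := F) hs hq hF
  have h2 : (2 : MvPolynomial OIdx2 F) = 0 := CharTwo.two_eq_zero
  have k1 := fun k => xiG_pow (F := F) hq k 1
  have k0 := fun k => xiG_pow (F := F) hq k 0
  simp only [pow_zero, pow_one, zero_add] at k0 k1
  refine ⟨?_, ?_, ?_⟩
  · rw [k1, k1, k1, k0]
    norm_num
    linear_combination X (some (.inr 0)) ^ q * r (.inl 0) + X (some (.inl 0)) ^ q * r (.inr 0)
      + X (some (.inr 1)) ^ q * r (.inl 1) + X (some (.inl 1)) ^ q * r (.inr 1)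
      - ((dickP F).coeff q * (X (some (.inr 0)) ^ q * X (some (.inl 0)) ^ q
        + X (some (.inr 1)) ^ q * X (some (.inl 1)) ^ q)) * h2
  · rw [xiG_pow hq, xiG_pow hq, k1, k0]
    norm_num
    linear_combination X (some (.inr 0)) ^ q ^ 2 * r (.inl 0)
      + X (some (.inl 0)) ^ q ^ 2 * r (.inr 0)
      + X (some (.inr 1)) ^ q ^ 2 * r (.inl 1) + X (some (.inl 1)) ^ q ^ 2 * r (.inr 1)
      - ((dickP F).coeff (q ^ 2) * (X (some (.inr 0)) ^ q ^ 2 * X (some (.inl 0)) ^ q ^ 2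
        + X (some (.inr 1)) ^ q ^ 2 * X (some (.inl 1)) ^ q ^ 2)) * h2
  · rw [xiG_pow hq, xiG_pow hq, k1, k0]
    norm_num
    linear_combination X (some (.inr 0)) ^ q ^ 3 * r (.inl 0)
      + X (some (.inl 0)) ^ q ^ 3 * r (.inr 0)
      + X (some (.inr 1)) ^ q ^ 3 * r (.inl 1) + X (some (.inl 1)) ^ q ^ 3 * r (.inr 1)
      - ((dickP F).coeff (q ^ 3) * (X (some (.inr 0)) ^ q ^ 3 * X (some (.inl 0)) ^ q ^ 3
        + X (some (.inr 1)) ^ q ^ 3 * X (some (.inl 1)) ^ q ^ 3)) * h2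

theorem e_sq [CharP F 2] {q h : ℕ} (hh : q = 2 * h)
    {ξ δ η b e : MvPolynomial OIdx2 F}
    (hb : b ^ 2 = δ + u2 q F ^ (q - 2) * (η + xiB F * ξ ^ q))
    (he : e = u2 q F ^ (h - 1) * ξ ^ h * X none + b) :
    e ^ 2 = δ + u2 q F ^ (q - 2) * (η + xiZ F * ξ ^ q) := by
  have e1 : (u2 q F ^ (h - 1)) ^ 2 = u2 q F ^ (q - 2) := by
    rw [← pow_mul]; congr 1; omega
  have e2 : (ξ ^ h) ^ 2 = ξ ^ q := by
    rw [← pow_mul]; congr 1; omega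
  rw [he, CharTwo.add_sq, mul_pow, mul_pow, e1, e2, hb, show xiZ F = X none ^ 2 + xiB F from rfl]
  ring

theorem xiG_three_relation [Fintype F] [CharP F 2] {s q h : ℕ} (hs : 2 ≤ s) (hq : q = 2 ^ s)
    (hh : q = 2 * h) (hF : Fintype.card F = q) {e1 e2 : MvPolynomial OIdx2 F}
    (he1 : e1 ^ 2 = (dickP F).coeff (q ^ 3) + u2 q F ^ (q - 2) *
      (xiG q F 1 * xiG q F 2 + xiZ F * xiG q F 1 ^ q))
    (he2 : e2 ^ 2 = (dickP F).coeff (q ^ 2) + u2 q F ^ (q - 2) *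
      (xiG q F 1 * xiG q F 3 + xiZ F * xiG q F 2 ^ q)) :
    xiG q F 3 ^ h = xiG q F 2 ^ h * e1 + xiG q F 1 ^ h * e2
      + u2 q F ^ (h - 1) * xiG q F 1 ^ (q * h + 1) := by
  have hq4 : 4 ≤ q := by
    rw [hq]; exact Nat.pow_le_pow_right (n := 2) two_pos hs
  have h2 : (2 : MvPolynomial OIdx2 F) = 0 := CharTwo.two_eq_zero
  have hpow : ∀ a : MvPolynomial OIdx2 F, (a ^ h) ^ 2 = a ^ q := fun a => by
    rw [← pow_mul]; congr 1; omega
  have e1' : (u2 q F ^ (h - 1)) ^ 2 = u2 q F ^ (q - 2) := by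
    rw [← pow_mul]; congr 1; omega
  have e2' : (xiG q F 1 ^ (q * h + 1)) ^ 2 = xiG q F 1 ^ (q ^ 2 + 1) * xiG q F 1 := by
    rw [← pow_mul, ← pow_succ]; congr 1; rw [sq]; nth_rw 3 [hh]; ring
  have e3 : u2 q F ^ (q - 1) = u2 q F ^ (q - 2) * u2 q F := by
    rw [← pow_succ]; congr 1; omega
  apply CharTwo.sq_injective
  simp only [CharTwo.add_sq, mul_pow]
  rw [hpow, hpow, hpow, e1', e2', he1, he2]
  have := (dickson_xiG (F := F) hs hq hF).1
  have hu : u2 q F = xiG q F 3 * xiG q F 1 ^ q + xiG q F 2 ^ (q + 1)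
      + xiG q F 1 ^ (q ^ 2 + 1) := rfl
  rw [e3] at this
  linear_combination this + u2 q F ^ (q - 2) * xiG q F 1 * hu
    - ((dickP F).coeff (q ^ 3) * xiG q F 2 ^ q
      + (dickP F).coeff (q ^ 2) * xiG q F 1 ^ q + u2 q F ^ (q - 2) * u2 q F * xiG q F 1
      + u2 q F ^ (q - 2) * xiZ F * xiG q F 1 ^ q * xiG q F 2 ^ q) * h2

end

section

variable {F : Type*} [Field F]

theorem linearForm_pow [Fintype F] [CharP F 2] {s q : ℕ} (hq : q = 2 ^ s)
    (hF : Fintype.card F = q) {ι : Type*} [Fintype ι] (c : ι → F) (k : ℕ) :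
    (∑ i, C (c i) * X i : MvPolynomial ι F) ^ q ^ k = ∑ i, C (c i) * X i ^ q ^ k := by
  have hck : ∀ i, c i ^ q ^ k = c i := fun i => by rw [← hF]; exact FiniteField.pow_card_pow k _
  rw [hq, ← pow_mul, sum_pow_char_pow, pow_mul, ← hq]
  simp [mul_pow, ← C_pow, hck]

theorem act_X {ι : Type*} [Fintype ι] [DecidableEq ι] (g : (ι → F) ≃ₗ[F] (ι → F)) (i : ι) :
    act g (X i) = ∑ j, C (g (Pi.single j 1) i) * X j := by
  simp [act]

variable (g : (OIdx2 → F) ≃ₗ[F] (OIdx2 → F))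

theorem act_xiG [Fintype F] [CharP F 2] {s q : ℕ} (hq : q = 2 ^ s)
    (hF : Fintype.card F = q) (hg : act g (xiZ F) = xiZ F) (k : ℕ) :
    act g (xiG q F k) = xiG q F k := by
  set θ : MvPolynomial OIdx2 F →ₐ[F] MvPolynomial OIdx2 F := aeval fun i => X i ^ q ^ k with hθ
  set τ : MvPolynomial OIdx2 F →ₐ[F] MvPolynomial OIdx2 F := aeval fun i => X i + X i ^ q ^ k
    with hτ
  have h1 : (act g).comp θ = θ.comp (act g) := by
    refine algHom_ext fun i => ?_
    simp only [AlgHom.comp_apply, hθ, aeval_X, map_pow, act_X, linearForm_pow hq hF, map_sum,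
      map_mul, algHom_C, algebraMap_eq]
  have h2 : (act g).comp τ = τ.comp (act g) := by
    refine algHom_ext fun i => ?_
    simp only [AlgHom.comp_apply, hτ, aeval_X, map_add, map_pow, act_X, linearForm_pow hq hF,
      map_sum, map_mul, algHom_C, algebraMap_eq, mul_add, Finset.sum_add_distrib]
  have h3 : xiG q F k = τ (xiZ F) - xiZ F - θ (xiZ F) := by
    simp only [xiG, xiZ, hτ, hθ, map_add, map_mul, map_pow, aeval_X, Fin.sum_univ_two]
    have h2 : (2 : MvPolynomial OIdx2 F) = 0 := CharTwo.two_eq_zero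
    linear_combination - X none * X none ^ q ^ k * h2
  have e1 := DFunLike.congr_fun h1 (xiZ F)
  have e2 := DFunLike.congr_fun h2 (xiZ F)
  simp only [AlgHom.comp_apply, hg] at e1 e2
  rw [h3, map_sub, map_sub, e1, e2, hg]

theorem act_u2 [Fintype F] [CharP F 2] {s q : ℕ} (hq : q = 2 ^ s)
    (hF : Fintype.card F = q) (hg : act g (xiZ F) = xiZ F) : act g (u2 q F) = u2 q F := by
  simp only [u2, map_add, map_mul, map_pow, act_xiG g hq hF hg]

theorem act_dickP_coeff [Fintype F] [CharP F 2] {s q : ℕ} (hs : 2 ≤ s) (hq : q = 2 ^ s)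
    (hF : Fintype.card F = q) (hg : act g (xiZ F) = xiZ F) :
    act g ((dickP F).coeff (q ^ 3)) = (dickP F).coeff (q ^ 3) ∧
    act g ((dickP F).coeff (q ^ 2)) = (dickP F).coeff (q ^ 2) := by
  have hξ := act_xiG g hq hF hg
  have hu := act_u2 g hq hF hg
  have h1 : act g ((dickP F).coeff (q ^ 3)) = (dickP F).coeff (q ^ 3) := by
    apply mul_left_cancel₀ (u2_ne_zero (F := F) hs hq)
    have h := (dickson_coeffs (F := F) hs hq hF).2
    have h' := congrArg (act g) h
    simp only [map_add, map_mul, map_pow, hξ, hu] at h'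
    rw [h', h]
  refine ⟨h1, ?_⟩
  have hq1 : 1 < q := by rw [hq]; exact Nat.one_lt_two_pow (by omega)
  apply mul_right_cancel₀ (pow_ne_zero q (xiG_one_ne_zero (F := F) hq1))
  have h := (dickson_xiG (F := F) hs hq hF).1
  have h' := congrArg (act g) h
  simp only [map_add, map_mul, map_pow, hξ, hu, h1, map_zero] at h'
  linear_combination h' - h

theorem act_eq_of_sq [CharP F 2] {e : MvPolynomial OIdx2 F} (h : act g (e ^ 2) = e ^ 2) :
    act g e = e := by
  apply CharTwo.sq_injective
  simpa using h

theorem act_eq_of_mem_adjoin {G : Set (MvPolynomial OIdx2 F)} (hG : ∀ a ∈ G, act g a = a)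
    {f : MvPolynomial OIdx2 F} (hf : f ∈ Algebra.adjoin F G) : act g f = f := by
  induction hf using Algebra.adjoin_induction with
  | mem a ha => exact hG a ha
  | algebraMap r => exact (act g).commutes r
  | add a b _ _ ha hb => rw [map_add, ha, hb]
  | mul a b _ _ ha hb => rw [map_mul, ha, hb]

end

section

theorem isIntegral_of_additive_eq_zero {R A : Type*} [CommRing R] [CommRing A] [Algebra R A]
    {q : ℕ} (hq : 1 < q) {a b c d : R} {w : A}
    (h : w ^ q ^ 4 + algebraMap R A a * w ^ q ^ 3 + algebraMap R A b * w ^ q ^ 2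
      + algebraMap R A c * w ^ q + algebraMap R A d * w = 0) : IsIntegral R w := by
  have l1 : q < q ^ 4 := by simpa using Nat.pow_lt_pow_right hq (by norm_num : 1 < 4)
  have l2 : q ^ 2 < q ^ 4 := Nat.pow_lt_pow_right hq (by norm_num)
  have l3 : q ^ 3 < q ^ 4 := Nat.pow_lt_pow_right hq (by norm_num)
  have hp : ∀ (c : R) m, m < q ^ 4 →
      (Polynomial.C c * Polynomial.X ^ m).degree < ((q ^ 4 : ℕ) : WithBot ℕ) := fun c m hm =>
    (Polynomial.degree_C_mul_X_pow_le _ _).trans_lt (by exact_mod_cast hm)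
  refine ⟨Polynomial.X ^ q ^ 4 + (Polynomial.C a * Polynomial.X ^ q ^ 3
    + Polynomial.C b * Polynomial.X ^ q ^ 2 + Polynomial.C c * Polynomial.X ^ q
    + Polynomial.C d * Polynomial.X ^ 1), Polynomial.monic_X_pow_add ?_, ?_⟩
  · refine (Polynomial.degree_add_le _ _).trans_lt (max_lt ((Polynomial.degree_add_le _ _).trans_lt
      (max_lt ((Polynomial.degree_add_le _ _).trans_lt (max_lt ?_ ?_)) ?_)) ?_)
    exacts [hp _ _ l3, hp _ _ l2, hp _ _ l1, hp _ _ (hq.trans l1)]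
  · simp only [Polynomial.eval₂_add, Polynomial.eval₂_mul, Polynomial.eval₂_pow,
      Polynomial.eval₂_X, Polynomial.eval₂_C, pow_one]
    rw [← h]; ring

variable {F : Type*} [Field F]

theorem dickP_coeff_mem [Fintype F] [CharP F 2] {s q : ℕ} (hs : 2 ≤ s) (hq : q = 2 ^ s)
    (hF : Fintype.card F = q) {e1 : MvPolynomial OIdx2 F}
    (he1 : e1 ^ 2 = (dickP F).coeff (q ^ 3) + u2 q F ^ (q - 2) *
      (xiG q F 1 * xiG q F 2 + xiZ F * xiG q F 1 ^ q))
    {B : Subalgebra F (MvPolynomial OIdx2 F)} (h0 : xiZ F ∈ B) (h1 : xiG q F 1 ∈ B)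
    (h2 : xiG q F 2 ∈ B) (h3 : xiG q F 3 ∈ B) (he : e1 ∈ B) :
    u2 q F ∈ B ∧ (dickP F).coeff (q ^ 3) ∈ B ∧ xiG q F 1 ^ q * (dickP F).coeff (q ^ 2) ∈ B ∧
      xiG q F 1 ^ q * (dickP F).coeff q ∈ B := by
  have hu : u2 q F ∈ B :=
    add_mem (add_mem (mul_mem h3 (pow_mem h1 _)) (pow_mem h2 _)) (pow_mem h1 _)
  have hd3 : (dickP F).coeff (q ^ 3) ∈ B := by
    rw [← sub_eq_iff_eq_add] at he1
    rw [← he1]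
    exact sub_mem (pow_mem he _) (mul_mem (pow_mem hu _)
      (add_mem (mul_mem h1 h2) (mul_mem h0 (pow_mem h1 _))))
  obtain ⟨r1, r2, -⟩ := dickson_xiG (F := F) hs hq hF
  refine ⟨hu, hd3, ?_, ?_⟩
  · have : xiG q F 1 ^ q * (dickP F).coeff (q ^ 2) = -(xiG q F 3 ^ q
        + (dickP F).coeff (q ^ 3) * xiG q F 2 ^ q + u2 q F ^ (q - 1) * xiG q F 1) := by
      linear_combination r1
    rw [this]
    exact neg_mem (add_mem (add_mem (pow_mem h3 _) (mul_mem hd3 (pow_mem h2 _)))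
      (mul_mem (pow_mem hu _) h1))
  · have : xiG q F 1 ^ q * (dickP F).coeff q = -(xiG q F 2 ^ q ^ 2
        + (dickP F).coeff (q ^ 3) * xiG q F 1 ^ q ^ 2 + u2 q F ^ (q - 1) * xiG q F 2) := by
      linear_combination r2
    rw [this]
    exact neg_mem (add_mem (add_mem (pow_mem h2 _) (mul_mem hd3 (pow_mem h1 _)))
      (mul_mem (pow_mem hu _) h2))

theorem isIntegral_xiG_pow_mul_X [Fintype F] [CharP F 2] {s q : ℕ} (hs : 2 ≤ s) (hq : q = 2 ^ s)
    (hF : Fintype.card F = q) {e1 : MvPolynomial OIdx2 F}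
    (he1 : e1 ^ 2 = (dickP F).coeff (q ^ 3) + u2 q F ^ (q - 2) *
      (xiG q F 1 * xiG q F 2 + xiZ F * xiG q F 1 ^ q))
    {B : Subalgebra F (MvPolynomial OIdx2 F)} (h0 : xiZ F ∈ B) (h1 : xiG q F 1 ∈ B)
    (h2 : xiG q F 2 ∈ B) (h3 : xiG q F 3 ∈ B) (he : e1 ∈ B) (i : OIdx2) :
    IsIntegral B (xiG q F 1 ^ q * X i) := by
  have hq1 : 1 < q := by rw [hq]; exact Nat.one_lt_two_pow (by omega)
  obtain ⟨hu, m3, m2, m1⟩ := dickP_coeff_mem hs hq hF he1 h0 h1 h2 h3 he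
  have hsome : ∀ t, IsIntegral B (xiG q F 1 ^ q * X (some t)) := by
    intro t
    have l1 : q < q ^ 4 := by simpa using Nat.pow_lt_pow_right hq1 (by norm_num : 1 < 4)
    have l2 : q ^ 2 < q ^ 4 := Nat.pow_lt_pow_right hq1 (by norm_num)
    have l3 : q ^ 3 < q ^ 4 := Nat.pow_lt_pow_right hq1 (by norm_num)
    have key : ∀ m < q ^ 4, xiG q F 1 ^ (q * q ^ 4) =
        xiG q F 1 ^ q * (xiG q F 1 ^ (q * (q ^ 4 - m - 1)) * (xiG q F 1 ^ q) ^ m) := by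
      intro m hm
      rw [← pow_mul, ← pow_add, ← pow_add, ← mul_add, ← mul_one_add]
      congr 2
      omega
    have hx : ∀ m, xiG q F 1 ^ m ∈ B := fun m => pow_mem h1 m
    refine isIntegral_of_additive_eq_zero hq1
      (a := (⟨_, mul_mem m3 (mul_mem (hx q) (hx (q * (q ^ 4 - q ^ 3 - 1))))⟩ : B))
      (b := (⟨_, mul_mem m2 (hx (q * (q ^ 4 - q ^ 2 - 1)))⟩ : B))
      (c := (⟨_, mul_mem m1 (hx (q * (q ^ 4 - q - 1)))⟩ : B))
      (d := (⟨_, mul_mem (pow_mem hu (q - 1))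
        (mul_mem (hx q) (hx (q * (q ^ 4 - 1 - 1))))⟩ : B)) ?_
    have r := dickson_root (F := F) hs hq hF t
    simp only [Subalgebra.algebraMap_def, Algebra.algebraMap_self, RingHom.id_apply]
    have k3 := key _ l3
    have k2 := key _ l2
    have k1 := key _ l1
    have k0 := key _ (hq1.trans l1)
    simp only [mul_pow, pow_one] at k0 k1 k2 k3 ⊢
    rw [← pow_mul]
    linear_combination xiG q F 1 ^ (q * q ^ 4) * r
      - (dickP F).coeff (q ^ 3) * X (some t) ^ q ^ 3 * k3
      - (dickP F).coeff (q ^ 2) * X (some t) ^ q ^ 2 * k2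
      - (dickP F).coeff q * X (some t) ^ q * k1
      - u2 q F ^ (q - 1) * X (some t) * k0
  rcases i with _ | t
  · refine IsIntegral.of_pow two_pos ?_
    have hx : IsIntegral B (xiG q F 1 ^ q) := isIntegral_algebraMap (x := (⟨_, pow_mem h1 q⟩ : B))
    have hz : IsIntegral B (xiZ F) := isIntegral_algebraMap (x := (⟨_, h0⟩ : B))
    have : (xiG q F 1 ^ q * X none) ^ 2 = xiG q F 1 ^ q * xiG q F 1 ^ q * xiZ F -
        ∑ j : Fin 2, (xiG q F 1 ^ q * X (some (Sum.inr j))) * (xiG q F 1 ^ q * X (some (Sum.inl j)))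
        := by
      simp only [xiZ, Fin.sum_univ_two]; ring
    rw [this]
    exact ((hx.mul hx).mul hz).sub (IsIntegral.sum _ fun j _ => (hsome _).mul (hsome _))
  · exact hsome t

theorem exists_isIntegral_pow_mul {σ : Type*} {B : Subalgebra F (MvPolynomial σ F)}
    {ξ : MvPolynomial σ F} (hξ : ξ ∈ B) {m : ℕ}
    (hX : ∀ i, IsIntegral B (ξ ^ m * X i)) (f : MvPolynomial σ F) :
    ∃ n, IsIntegral B (ξ ^ n * f) := by
  have hx : ∀ n, IsIntegral B (ξ ^ n) := fun n =>
    isIntegral_algebraMap (x := (⟨_, pow_mem hξ n⟩ : B))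
  induction f using MvPolynomial.induction_on with
  | C a => exact ⟨0, by
      rw [pow_zero, one_mul]; exact isIntegral_algebraMap (x := algebraMap F B a)⟩
  | add f g hf hg =>
    obtain ⟨n, hn⟩ := hf
    obtain ⟨k, hk⟩ := hg
    refine ⟨n + k, ?_⟩
    rw [show ξ ^ (n + k) * (f + g) = ξ ^ k * (ξ ^ n * f) + ξ ^ n * (ξ ^ k * g) by ring]
    exact ((hx _).mul hn).add ((hx _).mul hk)
  | mul_X f i hf =>
    obtain ⟨n, hn⟩ := hf
    refine ⟨n + m, ?_⟩
    rw [show ξ ^ (n + m) * (f * X i) = (ξ ^ n * f) * (ξ ^ m * X i) by ring]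
    exact hn.mul (hX i)

/-- An algebra over which every variable becomes integral after multiplication by a fixed
nonzero element, generated by as many elements as there are variables, is a polynomial ring. -/
theorem isIntegrallyClosed_adjoin {σ κ : Type*} [Fintype σ] [Fintype κ]
    (hc : Fintype.card κ = Fintype.card σ) {y : κ → MvPolynomial σ F}
    {ξ : MvPolynomial σ F} (hξ : ξ ∈ Algebra.adjoin F (Set.range y)) (hξ0 : ξ ≠ 0)
    (hX : ∀ i, IsIntegral (Algebra.adjoin F (Set.range y)) (ξ * X i)) :
    IsIntegrallyClosed (Algebra.adjoin F (Set.range y)) := by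
  have hy : AlgebraicIndependent F y := by
    refine algebraicIndependent_of_isAlgebraic (x := (X : σ → MvPolynomial σ F))
      (IsTranscendenceBasis.mvPolynomial σ F) hc fun i => ?_
    have h := (hX i).isAlgebraic
    exact IsAlgebraic.of_mul (mem_nonZeroDivisors_of_ne_zero hξ0)
      (isAlgebraic_algebraMap (⟨ξ, hξ⟩ : Algebra.adjoin F (Set.range y))) h
  exact IsIntegrallyClosed.of_equiv hy.aevalEquiv.toRingEquiv

end

open scoped Matrix


section

variable {F : Type*} [Field F]

theorem totalDegree_linearForm_le {σ τ : Type*} [Fintype τ] (c : τ → F) (x : τ → σ) :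
    (∑ i, C (c i) * X (x i) : MvPolynomial σ F).totalDegree ≤ 1 :=
  totalDegree_finsetSum_le fun i _ =>
    (totalDegree_mul _ _).trans (by rw [totalDegree_C, totalDegree_X])

/-- An automorphism of the fraction field fixing `ξ_0` and acting linearly on the `x_j`, `y_j` is
induced by an element of the linear group. -/
theorem exists_act_eq_of_linear {L : Type*} [Field L] [Algebra (MvPolynomial OIdx2 F) L]
    [IsFractionRing (MvPolynomial OIdx2 F) L] [Algebra F L] [IsScalarTower F (MvPolynomial OIdx2 F) L]
    (σ : L ≃ₐ[F] L)
    (h0 : σ (algebraMap _ L (xiZ F)) = algebraMap _ L (xiZ F))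
    (hx : ∀ t : Fin 2 ⊕ Fin 2, ∃ c : Fin 2 ⊕ Fin 2 → F,
      σ (algebraMap (MvPolynomial OIdx2 F) L (X (some t))) =
        algebraMap (MvPolynomial OIdx2 F) L (∑ i, C (c i) * X (some i))) :
    ∃ g : (OIdx2 → F) ≃ₗ[F] (OIdx2 → F), ∀ f,
      σ (algebraMap (MvPolynomial OIdx2 F) L f) = algebraMap _ L (act g f) := by
  have hinj := IsFractionRing.injective (MvPolynomial OIdx2 F) L
  choose c hc using hx
  set ℓ : Fin 2 ⊕ Fin 2 → MvPolynomial OIdx2 F := fun t => ∑ i, C (c t i) * X (some i) with hℓ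
  have hdeg : ∀ t, (ℓ t).totalDegree ≤ 1 := fun t => totalDegree_linearForm_le _ _
  have hconst : ∀ t, constantCoeff (ℓ t) = 0 := fun t => by simp [hℓ]
  have hsq : σ (algebraMap (MvPolynomial OIdx2 F) L (X none)) ^ 2 = algebraMap _ L
      (xiZ F - ∑ j : Fin 2, ℓ (Sum.inr j) * ℓ (Sum.inl j)) := by
    have : (X none ^ 2 : MvPolynomial OIdx2 F) = xiZ F - xiB F := by simp [xiZ, xiB]
    rw [← map_pow, ← map_pow, this, map_sub, map_sub, map_sub, h0, xiB, map_sum, map_sum, map_sum]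
    simp only [map_mul, hc, hℓ]
  obtain ⟨w, hw⟩ := IsIntegrallyClosed.exists_algebraMap_eq_of_isIntegral_pow
    (R := MvPolynomial OIdx2 F) (n := 2) two_pos (hsq ▸ isIntegral_algebraMap)
  have hw2 : w ^ 2 = xiZ F - ∑ j : Fin 2, ℓ (Sum.inr j) * ℓ (Sum.inl j) := by
    apply hinj
    rw [map_pow, hw, hsq]
  obtain ⟨d, hd⟩ := MvPolynomial.eq_sum_of_sq (p := w)
    (by
      have hX2 : ∀ a b : MvPolynomial OIdx2 F, a.totalDegree ≤ 1 → b.totalDegree ≤ 1 →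
          (a * b).totalDegree ≤ 2 := fun a b ha hb =>
        (totalDegree_mul _ _).trans (add_le_add ha hb)
      rw [hw2, xiZ, sq]
      refine (totalDegree_sub _ _).trans (max_le ((totalDegree_add _ _).trans (max_le ?_ ?_)) ?_)
      · exact hX2 _ _ (totalDegree_X _).le (totalDegree_X _).le
      · exact totalDegree_finsetSum_le fun j _ => hX2 _ _ (totalDegree_X _).le (totalDegree_X _).le
      · exact totalDegree_finsetSum_le fun j _ => hX2 _ _ (hdeg _) (hdeg _))
    (by rw [hw2]; simp [xiZ, hconst])
  obtain ⟨N, hN⟩ : ∃ N : Matrix OIdx2 OIdx2 F, ∀ i,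
      σ (algebraMap (MvPolynomial OIdx2 F) L (X i)) = algebraMap _ L (∑ j, C (N i j) * X j) := by
    refine ⟨fun i j => i.elim (d j) fun t => j.elim 0 (c t), fun i => ?_⟩
    rcases i with _ | t
    · simp only [Option.elim_none, ← hd, hw]
    · simp only [Option.elim_some, hc, Fintype.sum_option, Option.elim_none, map_zero, zero_mul,
        zero_add]
  have hact : ∀ a : OIdx2 → F, σ (algebraMap (MvPolynomial OIdx2 F) L (∑ i, C (a i) * X i)) =
      algebraMap _ L (∑ j, C (Matrix.vecMul a N j) * X j) := by
    intro a
    have hC : ∀ r : F, σ (algebraMap (MvPolynomial OIdx2 F) L (C r)) =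
        algebraMap (MvPolynomial OIdx2 F) L (C r) := by
      intro r
      rw [← algebraMap_eq, ← IsScalarTower.algebraMap_apply, σ.commutes]
    simp only [map_sum, map_mul, hC, hN]
    simp only [← map_mul, ← map_sum]
    congr 1
    simp only [Matrix.vecMul, dotProduct, Finset.mul_sum, map_sum, map_mul, Finset.sum_mul]
    rw [Finset.sum_comm]
    simp only [mul_assoc]
  have hNu : IsUnit N := by
    rw [← Matrix.vecMul_injective_iff_isUnit]
    intro a b hab
    have h := hact a
    rw [show a ᵥ* N = b ᵥ* N from hab, ← hact b] at h
    have h' := hinj (σ.injective h)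
    funext i
    simpa [coeff_sum, coeff_C_mul, coeff_X, Finsupp.single_left_inj, -Fintype.sum_sum_type,
      -Fintype.sum_option] using congrArg (coeff (Finsupp.single i 1)) h'
  have hNi := Matrix.mulVec_injective_iff_isUnit.2 hNu
  set g := LinearEquiv.ofInjectiveEndo N.mulVecLin hNi with hg
  have hgN : ∀ i j, g (Pi.single j 1) i = N i j := fun i j => by
    change (N *ᵥ Pi.single j 1) i = N i j
    simp
  have hgf : (σ : L →ₐ[F] L).comp (IsScalarTower.toAlgHom F (MvPolynomial OIdx2 F) L) =
      (IsScalarTower.toAlgHom F (MvPolynomial OIdx2 F) L).comp (act g) := by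
    refine algHom_ext fun i => ?_
    simp only [AlgHom.comp_apply, IsScalarTower.coe_toAlgHom', act_X, hgN]
    exact hN i
  exact ⟨g, fun f => DFunLike.congr_fun hgf f⟩

end

section

variable {F : Type*} [Field F]

theorem aeval_elim_dickP [Fintype F] (n : ℕ) :
    aeval (fun i : OIdx2 => i.elim (0 : MvPolynomial OIdx2 F) fun t => X (some t))
      ((dickP F).coeff n) = (dickP F).coeff n := by
  have : (dickP F).map (aeval (fun i : OIdx2 => i.elim (0 : MvPolynomial OIdx2 F)
      fun t => X (some t))).toRingHom = dickP F := by
    rw [dickP, Polynomial.map_prod]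
    refine Finset.prod_congr rfl fun c _ => ?_
    simp
  conv_rhs => rw [← this, Polynomial.coeff_map]
  rfl

theorem aeval_elim_eq_of_sq [Fintype F] [CharP F 2] {q k l m n : ℕ} {b : MvPolynomial OIdx2 F}
    (hb : b ^ 2 = (dickP F).coeff n + u2 q F ^ m *
      (xiG q F 1 * xiG q F k + xiB F * xiG q F l ^ q)) :
    aeval (fun i : OIdx2 => i.elim (0 : MvPolynomial OIdx2 F) fun t => X (some t)) b = b := by
  apply CharTwo.sq_injective
  change _ ^ 2 = b ^ 2
  rw [← map_pow, hb, map_add, aeval_elim_dickP]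
  simp [u2, xiG, xiB]

theorem mem_bot_of_act_eq [Fintype F] [CharP F 2] {L : Type*} [Field L]
    [Algebra (MvPolynomial OIdx2 F) L] [IsFractionRing (MvPolynomial OIdx2 F) L] [Algebra F L]
    [IsScalarTower F (MvPolynomial OIdx2 F) L] (K : IntermediateField F L)
    (h0 : algebraMap _ L (xiZ F) ∈ K)
    (hd : ∀ n, algebraMap _ L ((dickP F).coeff n) ∈ K)
    {c b : MvPolynomial OIdx2 F} (hc0 : c ≠ 0) (hc : algebraMap _ L c ∈ K)
    (hb : aeval (fun i : OIdx2 => i.elim (0 : MvPolynomial OIdx2 F) fun t => X (some t)) b = b)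
    (he : algebraMap _ L (c * X none + b) ∈ K) {f : MvPolynomial OIdx2 F}
    (hf : ∀ g : (OIdx2 → F) ≃ₗ[F] (OIdx2 → F), act g (xiZ F) = xiZ F → act g f = f) :
    algebraMap _ L f ∈ K := by
  classical
  have hinj := IsFractionRing.injective (MvPolynomial OIdx2 F) L
  obtain ⟨p, hp⟩ : ∃ p : Polynomial K, p.map (algebraMap K L) =
      (dickP F).map (algebraMap (MvPolynomial OIdx2 F) L) := by
    rw [← Polynomial.mem_lifts, Polynomial.lifts_iff_coeff_lifts]
    intro n
    rw [Polynomial.coeff_map]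
    exact ⟨⟨_, hd n⟩, rfl⟩
  set ℓ : (Fin 2 ⊕ Fin 2 → F) → L := fun a =>
    algebraMap (MvPolynomial OIdx2 F) L (∑ i, C (a i) * X (some i)) with hℓ
  have hprod : p.map (algebraMap K L) = ∏ a, (Polynomial.X - Polynomial.C (ℓ a)) := by
    rw [hp, dickP, Polynomial.map_prod]
    refine Finset.prod_congr rfl fun a _ => ?_
    have : CharP L 2 := charP_of_injective_algebraMap (algebraMap F L).injective 2
    rw [Polynomial.map_add, Polynomial.map_X, Polynomial.map_C, CharTwo.sub_eq_add]
  have hroot : ∀ x : L, Polynomial.aeval x p = 0 ↔ ∃ a, x = ℓ a := by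
    intro x
    rw [← Polynomial.eval_map_algebraMap, hprod, Polynomial.eval_prod, Finset.prod_eq_zero_iff]
    simp [sub_eq_zero]
  have hsep : p.Separable := by
    rw [← Polynomial.separable_map (algebraMap K L), hprod, Polynomial.separable_prod_X_sub_C_iff]
    exact hinj.comp linearForm_injective
  have hX : ∀ t, algebraMap (MvPolynomial OIdx2 F) L (X (some t)) = ℓ (Pi.single t 1) := by
    intro t
    rw [hℓ]
    dsimp only
    rw [Finset.sum_eq_single t] <;> simp +contextual
  have hsplit : p.IsSplittingField K L := by
    rw [isSplittingField_iff_intermediateField]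
    refine ⟨by rw [hprod]; exact Polynomial.Splits.prod fun a _ => Polynomial.Splits.X_sub_C _, ?_⟩
    set M := IntermediateField.adjoin K (p.rootSet L) with hM
    have hKM : ∀ x ∈ K, x ∈ M := fun x hx => M.algebraMap_mem ⟨x, hx⟩
    have hFM : ∀ a : F, algebraMap (MvPolynomial OIdx2 F) L (C a) ∈ M := fun a => by
      rw [← algebraMap_eq, ← IsScalarTower.algebraMap_apply]
      exact hKM _ (K.algebraMap_mem a)
    have hXM : ∀ t, algebraMap (MvPolynomial OIdx2 F) L (X (some t)) ∈ M := fun t => by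
      refine IntermediateField.subset_adjoin _ _ ?_
      rw [Polynomial.mem_rootSet]
      exact ⟨hsep.ne_zero, (hroot _).2 ⟨_, hX t⟩⟩
    have hψ : ∀ r : MvPolynomial OIdx2 F, algebraMap (MvPolynomial OIdx2 F) L (aeval
        (fun i : OIdx2 => i.elim (0 : MvPolynomial OIdx2 F) fun t => X (some t)) r) ∈ M := by
      intro r
      induction r using MvPolynomial.induction_on with
      | C a => simpa using hFM a
      | add r r' h h' => rw [map_add, map_add]; exact add_mem h h'
      | mul_X r i h =>
        rw [map_mul, map_mul]
        refine mul_mem h ?_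
        rcases i with _ | t
        · simp
        · simpa using hXM t
    have hz : algebraMap (MvPolynomial OIdx2 F) L (X none) ∈ M := by
      have hbM := hψ b
      rw [hb] at hbM
      have := div_mem (sub_mem (hKM _ he) hbM) (hKM _ hc)
      rwa [map_add, add_sub_cancel_right, map_mul, mul_div_cancel_left₀ _
        ((map_ne_zero_iff _ hinj).2 hc0)] at this
    have hS : ∀ r : MvPolynomial OIdx2 F, algebraMap (MvPolynomial OIdx2 F) L r ∈ M := by
      intro r
      induction r using MvPolynomial.induction_on with
      | C a => exact hFM a
      | add r r' h h' => rw [map_add]; exact add_mem h h'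
      | mul_X r i h =>
        rw [map_mul]
        refine mul_mem h ?_
        rcases i with _ | t
        · exact hz
        · exact hXM t
    refine eq_top_iff.2 fun x _ => ?_
    obtain ⟨r, s, -, rfl⟩ := IsFractionRing.div_surjective (A := MvPolynomial OIdx2 F) x
    exact div_mem (hS r) (hS s)
  have hgal : IsGalois K L := IsGalois.of_separable_splitting_field hsep
  have hfix : algebraMap _ L f ∈ (⊥ : IntermediateField K L) := by
    rw [InfiniteGalois.mem_bot_iff_fixed]
    intro σ
    have hσK : ∀ x ∈ K, σ x = x := fun x hx => σ.commutes ⟨x, hx⟩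
    obtain ⟨g, hg⟩ := exists_act_eq_of_linear (σ.restrictScalars F) (hσK _ h0) (fun t => by
      obtain ⟨a, ha⟩ := (hroot (σ (algebraMap _ L (X (some t))))).1 (by
        rw [Polynomial.aeval_algHom_apply σ, (hroot _).2 ⟨_, hX t⟩, map_zero])
      exact ⟨a, ha⟩)
    have hg' : ∀ f, σ (algebraMap (MvPolynomial OIdx2 F) L f) = algebraMap _ L (act g f) := hg
    rw [hg', hf g (hinj (by rw [← hg', hσK _ h0]))]
  obtain ⟨y, hy⟩ := IntermediateField.mem_bot.1 hfix
  rw [← hy]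
  exact y.2

end

section

variable {F : Type*} [Field F]

theorem exists_xiG_pow_mul_mem [Fintype F] [CharP F 2] {s q h : ℕ} (hs : 2 ≤ s) (hq : q = 2 ^ s)
    (hF : Fintype.card F = q) {b e : MvPolynomial OIdx2 F}
    (hb : aeval (fun i : OIdx2 => i.elim (0 : MvPolynomial OIdx2 F) fun t => X (some t)) b = b)
    (he : e = u2 q F ^ (h - 1) * xiG q F 1 ^ h * X none + b)
    (he2 : e ^ 2 = (dickP F).coeff (q ^ 3) + u2 q F ^ (q - 2) *
      (xiG q F 1 * xiG q F 2 + xiZ F * xiG q F 1 ^ q)) {f : MvPolynomial OIdx2 F}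
    (hf : ∀ g : (OIdx2 → F) ≃ₗ[F] (OIdx2 → F), act g (xiZ F) = xiZ F → act g f = f) :
    ∃ n, xiG q F 1 ^ n * f ∈ Algebra.adjoin F {xiZ F, xiG q F 1, xiG q F 2, xiG q F 3, e} := by
  have hq1 : 1 < q := by rw [hq]; exact Nat.one_lt_two_pow (by omega)
  have hξ := xiG_one_ne_zero (F := F) hq1
  set y : Fin 5 → MvPolynomial OIdx2 F := ![xiZ F, xiG q F 1, xiG q F 2, xiG q F 3, e] with hy
  have hrange : ({xiZ F, xiG q F 1, xiG q F 2, xiG q F 3, e} : Set _) = Set.range y := by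
    ext r
    simp only [hy, Matrix.range_cons, Matrix.range_empty, Set.union_empty, Set.singleton_union]
  rw [hrange]
  set B := Algebra.adjoin F (Set.range y) with hB
  have hyB : ∀ i, y i ∈ B := fun i => Algebra.subset_adjoin ⟨i, rfl⟩
  have m0 : xiZ F ∈ B := hyB 0
  have m1 : xiG q F 1 ∈ B := hyB 1
  have m2 : xiG q F 2 ∈ B := hyB 2
  have m3 : xiG q F 3 ∈ B := hyB 3
  have me : e ∈ B := hyB 4
  have hX := isIntegral_xiG_pow_mul_X hs hq hF he2 m0 m1 m2 m3 me
  have hic : IsIntegrallyClosed B := isIntegrallyClosed_adjoin (by simp) (pow_mem m1 q)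
    (pow_ne_zero q hξ) hX
  obtain ⟨hu, d3, d2, d1⟩ := dickP_coeff_mem hs hq hF he2 m0 m1 m2 m3 me
  let L := FractionRing (MvPolynomial OIdx2 F)
  have hinj := IsFractionRing.injective (MvPolynomial OIdx2 F) L
  let ι := IsScalarTower.toAlgHom F (MvPolynomial OIdx2 F) L
  set K := IntermediateField.adjoin F (ι '' Set.range y) with hK
  have hBK : ∀ r ∈ B, algebraMap _ L r ∈ K := by
    intro r hr
    have : B.map ι ≤ K.toSubalgebra := by
      rw [hB, AlgHom.map_adjoin]
      exact IntermediateField.algebra_adjoin_le_adjoin _ _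
    exact this ⟨r, hr, rfl⟩
  have hBK' : ∀ r, xiG q F 1 ^ q * r ∈ B → algebraMap _ L r ∈ K := by
    intro r hr
    have := div_mem (hBK _ hr) (hBK _ (pow_mem m1 q))
    rwa [map_mul, mul_div_cancel_left₀ _
      ((map_ne_zero_iff _ hinj).2 (pow_ne_zero q hξ))] at this
  have hdK : ∀ n, algebraMap _ L ((dickP F).coeff n) ∈ K := by
    intro n
    rw [(dickson_coeffs (F := F) hs hq hF).1]
    simp only [Polynomial.coeff_add, Polynomial.coeff_C_mul, Polynomial.coeff_X_pow,
      Polynomial.coeff_X, mul_ite, mul_one, mul_zero, map_add]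
    refine add_mem (add_mem (add_mem (add_mem ?_ ?_) ?_) ?_) ?_
    all_goals split_ifs
    all_goals first
      | (rw [map_zero]; exact zero_mem _)
      | (rw [map_one]; exact one_mem _)
      | exact hBK _ d3
      | exact hBK' _ d2
      | exact hBK' _ d1
      | exact hBK _ (pow_mem hu _)
  have hfK : algebraMap _ L f ∈ K := mem_bot_of_act_eq K (hBK _ m0) hdK
    (mul_ne_zero (pow_ne_zero _ (u2_ne_zero hs hq)) (pow_ne_zero _ hξ))
    (hBK _ (mul_mem (pow_mem hu (h - 1)) (pow_mem m1 h))) hb (hBK _ (he ▸ me)) hf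
  rw [hK, IntermediateField.mem_adjoin_iff_div, ← AlgHom.map_adjoin] at hfK
  obtain ⟨_, ⟨r, hr, rfl⟩, _, ⟨t, ht, rfl⟩, hrt⟩ := hfK
  obtain ⟨n, hn⟩ := exists_isIntegral_pow_mul m1 hX f
  refine ⟨n, ?_⟩
  by_cases ht0 : t = 0
  · have : f = 0 := hinj (by rw [hrt, ht0]; simp)
    rw [this, mul_zero]
    exact zero_mem _
  have htf : t * f = r := by
    apply hinj
    rw [map_mul, hrt, mul_comm]
    exact div_mul_cancel₀ _ ((map_ne_zero_iff _ hinj).2 ht0)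
  obtain ⟨c, hc⟩ := mem_range_of_isIntegral_of_mul_eq hn (b := (⟨t, ht⟩ : B))
    (a := ⟨_, mul_mem (pow_mem m1 n) hr⟩) (fun h0 => ht0 (congrArg Subtype.val h0)) (by
      change t * (xiG q F 1 ^ n * f) = xiG q F 1 ^ n * r
      rw [← htf]; ring)
  rw [← hc]
  exact c.2

end

section

variable {F : Type*} [Field F]

theorem irreducible_X_pow_sub_C_X_pow_mul_X {σ : Type*} {i j : σ} (hij : i ≠ j) {n : ℕ}
    (hn : 0 < n) (k : ℕ) :
    Irreducible (Polynomial.X ^ n - Polynomial.C (X i ^ k * X j) :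
      Polynomial (MvPolynomial σ F)) := by
  have hp : Prime (X j : MvPolynomial σ F) := X_prime
  have hmon : (Polynomial.X ^ n - Polynomial.C (X i ^ k * X j) :
      Polynomial (MvPolynomial σ F)).Monic := Polynomial.monic_X_pow_sub_C _ hn.ne'
  refine Polynomial.irreducible_of_eisenstein_criterion
    ((Ideal.span_singleton_prime hp.ne_zero).2 hp) ?_ ?_ ?_ ?_ hmon.isPrimitive
  · rw [hmon.leadingCoeff, Ideal.mem_span_singleton]
    exact hp.not_dvd_one
  · intro m hm
    rw [Polynomial.degree_X_pow_sub_C hn, Nat.cast_lt] at hm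
    rw [Polynomial.coeff_sub, Polynomial.coeff_X_pow, if_neg hm.ne, zero_sub, Polynomial.coeff_C,
      Ideal.mem_span_singleton]
    split_ifs
    · exact (dvd_mul_left _ _).neg_right
    · simp
  · rw [Polynomial.degree_X_pow_sub_C hn]
    exact_mod_cast hn
  · rw [Polynomial.coeff_sub, Polynomial.coeff_X_pow, if_neg hn.ne, zero_sub,
      Polynomial.coeff_C_zero, Ideal.span_singleton_pow, Ideal.mem_span_singleton, dvd_neg, sq]
    intro h
    exact hij (X_dvd_X.1 (hp.dvd_of_dvd_pow ((mul_dvd_mul_iff_right hp.ne_zero).1 h))).symm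

/-- Specialisation of the generators to a generic point of `ξ_1 = 0`. -/
theorem algebraicIndependent_generic_zero [Fintype F] [CharP F 2] {s q h : ℕ} (hs : 2 ≤ s)
    (hq : q = 2 ^ s) (hF : Fintype.card F = q) (hh0 : 0 < h)
    {e1 e2 : MvPolynomial OIdx2 F}
    (he1 : e1 ^ 2 = (dickP F).coeff (q ^ 3) + u2 q F ^ (q - 2) *
      (xiG q F 1 * xiG q F 2 + xiZ F * xiG q F 1 ^ q))
    (he2 : e2 ^ 2 = (dickP F).coeff (q ^ 2) + u2 q F ^ (q - 2) *
      (xiG q F 1 * xiG q F 3 + xiZ F * xiG q F 2 ^ q))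
    {D : Type*} [Field D] [Algebra F D] {x : Fin 4 → D} {φ : MvPolynomial OIdx2 F →ₐ[F] D}
    (hx : IsTranscendenceBasis F x) (hxφ : ∀ i, ∃ j, x i = φ (X j))
    (h1 : φ (xiG q F 1) = 0) (h2 : φ (xiG q F 2) ≠ 0)
    (h3 : φ (xiG q F 3) ^ h = φ (xiG q F 2) ^ h * φ e1) :
    AlgebraicIndependent F ![φ (xiZ F), φ (xiG q F 2), φ e1, φ e2] := by
  set y : Fin 4 → D := ![φ (xiZ F), φ (xiG q F 2), φ e1, φ e2] with hy
  have hq1 : 1 < q := by rw [hq]; exact Nat.one_lt_two_pow (by omega)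
  have hq0 : q ≠ 0 := by omega
  set K := Subalgebra.algebraicClosure (Algebra.adjoin F (Set.range y)) D with hK
  have hyK : ∀ i, y i ∈ K := fun i =>
    isAlgebraic_algebraMap (⟨_, Algebra.subset_adjoin ⟨i, rfl⟩⟩ : Algebra.adjoin F (Set.range y))
  have m0 : φ (xiZ F) ∈ K := hyK 0
  have m2 : φ (xiG q F 2) ∈ K := hyK 1
  have me1 : φ e1 ∈ K := hyK 2
  have me2 : φ e2 ∈ K := hyK 3
  have m3 : φ (xiG q F 3) ∈ K :=
    IsAlgebraic.of_pow (n := h) hh0 (h3 ▸ mul_mem (pow_mem m2 h) me1)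
  have mu : φ (u2 q F) ∈ K := by
    simp only [u2, map_add, map_mul, map_pow, h1, zero_pow hq0, mul_zero, zero_add,
      zero_pow (Nat.succ_ne_zero _), add_zero]
    exact pow_mem m2 _
  have d3 : φ ((dickP F).coeff (q ^ 3)) ∈ K := by
    have := congrArg φ he1
    simp only [map_add, map_mul, map_pow, h1, zero_pow hq0, mul_zero, zero_mul, add_zero] at this
    rw [← this]
    exact pow_mem me1 2
  have d2 : φ ((dickP F).coeff (q ^ 2)) ∈ K := by
    have := congrArg φ he2
    simp only [map_add, map_mul, map_pow, h1, zero_mul, zero_add] at this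
    rw [← sub_eq_iff_eq_add] at this
    rw [← this]
    exact sub_mem (pow_mem me2 2) (mul_mem (pow_mem mu _) (mul_mem m0 (pow_mem m2 _)))
  have d1 : φ ((dickP F).coeff q) ∈ K := by
    have := congrArg φ (dickson_xiG (F := F) hs hq hF).2.2
    simp only [map_add, map_mul, map_pow, h1, map_zero, zero_pow (pow_ne_zero _ hq0), mul_zero,
      zero_add] at this
    rw [add_eq_zero_iff_eq_neg, ← eq_div_iff (pow_ne_zero _ h2), div_eq_mul_inv] at this
    rw [this]
    exact mul_mem (neg_mem (mul_mem (pow_mem mu _) m3)) (IsAlgebraic.inv (pow_mem m2 q))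
  have hsome : ∀ t, φ (X (some t)) ∈ K := by
    intro t
    have r := congrArg φ (dickson_root (F := F) hs hq hF t)
    simp only [map_add, map_mul, map_pow, map_zero] at r
    have hint : IsIntegral K (φ (X (some t))) :=
      isIntegral_of_additive_eq_zero hq1 (a := (⟨_, d3⟩ : K)) (b := (⟨_, d2⟩ : K))
        (c := (⟨_, d1⟩ : K)) (d := (⟨_, pow_mem mu (q - 1)⟩ : K)) r
    exact hint.trans_isAlgebraic _
  have hX : ∀ i, φ (X i) ∈ K := by
    rintro (_ | t)
    · refine IsAlgebraic.of_pow (n := 2) two_pos ?_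
      have : φ (X none) ^ 2 = φ (xiZ F) -
          ∑ j : Fin 2, φ (X (some (Sum.inr j))) * φ (X (some (Sum.inl j))) := by
        simp [xiZ]
      rw [this]
      exact sub_mem (S := Subalgebra _ D) m0 (sum_mem fun j _ => mul_mem (hsome _) (hsome _))
    · exact hsome t
  refine algebraicIndependent_of_isAlgebraic hx rfl fun i => ?_
  obtain ⟨j, hj⟩ := hxφ i
  rw [hj]
  exact hX j

end

section

variable {F : Type u} [Field F]

theorem dvd_of_aeval_eq_zero {R S : Type*} [CommRing R] [IsDomain R] [IsIntegrallyClosed R]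
    [CommRing S] [IsDomain S] [Algebra R S] [FaithfulSMul R S] {w : S} {m p : Polynomial R}
    (hm : m.Monic) (hirr : Irreducible m) (hw : Polynomial.aeval w m = 0)
    (hp : Polynomial.aeval w p = 0) : m ∣ p := by
  have hint : IsIntegral R w := ⟨m, hm, hw⟩
  obtain ⟨r, hr⟩ := minpoly.isIntegrallyClosed_dvd hint hw
  have hu : IsUnit r := (hirr.isUnit_or_isUnit hr).resolve_left (minpoly.not_isUnit R w)
  exact (hr ▸ (hu.mul_right_dvd.2 dvd_rfl)).trans (minpoly.isIntegrallyClosed_dvd hint hp)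

/-- The generators modulo `ξ_1` satisfy only the relation `ξ_3^h = ξ_2^h e_1`. -/
theorem exists_algHom_ker_eq [Fintype F] [CharP F 2] {s q h : ℕ} (hs : 2 ≤ s)
    (hq : q = 2 ^ s) (hh : q = 2 * h) (hF : Fintype.card F = q) {e1 e2 : MvPolynomial OIdx2 F}
    (he1 : e1 ^ 2 = (dickP F).coeff (q ^ 3) + u2 q F ^ (q - 2) *
      (xiG q F 1 * xiG q F 2 + xiZ F * xiG q F 1 ^ q))
    (he2 : e2 ^ 2 = (dickP F).coeff (q ^ 2) + u2 q F ^ (q - 2) *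
      (xiG q F 1 * xiG q F 3 + xiZ F * xiG q F 2 ^ q)) :
    ∃ (D : Type u) (_ : Field D) (φ : MvPolynomial OIdx2 F →+* D), φ (xiG q F 1) = 0 ∧
      ∀ a ∈ Algebra.adjoin F {xiZ F, xiG q F 1, xiG q F 2, xiG q F 3, e1, e2}, φ a = 0 →
        ∃ b ∈ Algebra.adjoin F {xiZ F, xiG q F 1, xiG q F 2, xiG q F 3, e1, e2},
          a = xiG q F 1 * b := by
  have hq4 : 4 ≤ q := by rw [hq]; exact Nat.pow_le_pow_right (n := 2) two_pos hs
  have hh0 : 0 < h := by omega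
  set A := Algebra.adjoin F {xiZ F, xiG q F 1, xiG q F 2, xiG q F 3, e1, e2} with hA
  have m0 : xiZ F ∈ A := Algebra.subset_adjoin (by simp)
  have m1 : xiG q F 1 ∈ A := Algebra.subset_adjoin (by simp)
  have m2 : xiG q F 2 ∈ A := Algebra.subset_adjoin (by simp)
  have m3 : xiG q F 3 ∈ A := Algebra.subset_adjoin (by simp)
  have me1 : e1 ∈ A := Algebra.subset_adjoin (by simp)
  have me2 : e2 ∈ A := Algebra.subset_adjoin (by simp)
  have mu : u2 q F ∈ A :=
    add_mem (add_mem (mul_mem m3 (pow_mem m1 _)) (pow_mem m2 _)) (pow_mem m1 _)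
  have hrel := xiG_three_relation hs hq hh hF he1 he2
  obtain ⟨D, _, _, x, φ, hx, hxφ, h1, h2⟩ := exists_generic_zero (F := F) hs hq
  refine ⟨D, inferInstance, φ, h1, ?_⟩
  have h3 : φ (xiG q F 3) ^ h = φ (xiG q F 2) ^ h * φ e1 := by
    have := congrArg φ hrel
    simpa [h1, zero_pow hh0.ne'] using this
  have hy := algebraicIndependent_generic_zero hs hq hF hh0 he1 he2 hx hxφ h1 h2 h3
  set y : Fin 4 → MvPolynomial OIdx2 F := ![xiZ F, xiG q F 2, e1, e2] with hyd
  have hφy : ![φ (xiZ F), φ (xiG q F 2), φ e1, φ e2] = φ ∘ y := by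
    funext i; fin_cases i <;> rfl
  rw [hφy] at hy
  let θ : MvPolynomial (Fin 4) F →ₐ[F] MvPolynomial OIdx2 F := aeval y
  let _ : Algebra (MvPolynomial (Fin 4) F) D := ((φ.comp θ : _ →ₐ[F] D) : _ →+* D).toAlgebra
  have hφθ : φ.comp θ = aeval (φ ∘ y) := by
    refine algHom_ext fun i => ?_
    simp [θ]
  have : FaithfulSMul (MvPolynomial (Fin 4) F) D := by
    rw [faithfulSMul_iff_algebraMap_injective]
    change Function.Injective (φ.comp θ)
    rw [hφθ]
    exact hy
  let Θ : Polynomial (MvPolynomial (Fin 4) F) →+* MvPolynomial OIdx2 F :=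
    Polynomial.eval₂RingHom (θ : _ →+* _) (xiG q F 3)
  have hΘC : ∀ r, Θ (Polynomial.C r) = θ r := fun r => Polynomial.eval₂_C _ _
  have hΘX : Θ Polynomial.X = xiG q F 3 := Polynomial.eval₂_X _ _
  have hθX : ∀ i, θ (X i) = y i := fun i => aeval_X _ _
  have hφΘ : ∀ p, φ (Θ p) = Polynomial.aeval (φ (xiG q F 3)) p := fun p =>
    Polynomial.hom_eval₂ p (θ : _ →+* _) (φ : _ →+* D) (xiG q F 3)
  have hθA : ∀ r, θ r ∈ A := fun r => by
    have : θ.range ≤ A := by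
      rw [← Algebra.adjoin_range_eq_range_aeval, Algebra.adjoin_le_iff]
      rintro _ ⟨i, rfl⟩
      fin_cases i
      exacts [m0, m2, me1, me2]
    exact this ⟨r, rfl⟩
  have hΘA : ∀ p, Θ p ∈ A := fun p => by
    induction p using Polynomial.induction_on' with
    | add p p' hp hp' => rw [map_add]; exact add_mem hp hp'
    | monomial n r =>
      rw [← Polynomial.C_mul_X_pow_eq_monomial, map_mul, map_pow, hΘC, hΘX]
      exact mul_mem (hθA r) (pow_mem m3 n)
  have hdecomp : ∀ a ∈ A, ∃ p, ∃ b ∈ A, a = Θ p + xiG q F 1 * b := by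
    intro a ha
    induction ha using Algebra.adjoin_induction with
    | mem a ha =>
      have hθ : ∀ i, ∃ p, ∃ b ∈ A, y i = Θ p + xiG q F 1 * b := fun i =>
        ⟨Polynomial.C (X i), 0, zero_mem _, by rw [hΘC, hθX, mul_zero, add_zero]⟩
      rcases ha with rfl | rfl | rfl | rfl | rfl | rfl
      · exact hθ 0
      · exact ⟨0, 1, one_mem _, by simp⟩
      · exact hθ 1
      · exact ⟨Polynomial.X, 0, zero_mem _, by rw [hΘX, mul_zero, add_zero]⟩
      · exact hθ 2
      · exact hθ 3
    | algebraMap r =>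
      exact ⟨Polynomial.C (C r), 0, zero_mem _, by
        rw [hΘC, mul_zero, add_zero]; exact (θ.commutes r).symm⟩
    | add a a' _ _ ha ha' =>
      obtain ⟨p, b, hb, rfl⟩ := ha
      obtain ⟨p', b', hb', rfl⟩ := ha'
      exact ⟨p + p', b + b', add_mem hb hb', by rw [map_add]; ring⟩
    | mul a a' _ _ ha ha' =>
      obtain ⟨p, b, hb, rfl⟩ := ha
      obtain ⟨p', b', hb', rfl⟩ := ha'
      refine ⟨p * p', b * Θ p' + Θ p * b' + xiG q F 1 * (b * b'), ?_, by rw [map_mul]; ring⟩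
      exact add_mem (add_mem (mul_mem hb (hΘA _)) (mul_mem (hΘA _) hb'))
        (mul_mem m1 (mul_mem hb hb'))
  have hpow : ∀ n, 0 < n → xiG q F 1 ^ n = xiG q F 1 * xiG q F 1 ^ (n - 1) := fun n hn => by
    rw [← pow_succ', Nat.sub_add_cancel hn]
  set m : Polynomial (MvPolynomial (Fin 4) F) :=
    Polynomial.X ^ h - Polynomial.C (X 1 ^ h * X 2) with hm
  have hΘm : Θ m = xiG q F 1 * (xiG q F 1 ^ (h - 1) * e2
      + u2 q F ^ (h - 1) * xiG q F 1 ^ (q * h)) := by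
    have e : Θ m = xiG q F 3 ^ h - xiG q F 2 ^ h * e1 := by
      rw [hm, map_sub, map_pow, hΘC, hΘX, map_mul, map_pow, hθX, hθX]; rfl
    rw [e, hrel, hpow h hh0]
    ring
  intro a ha ha0
  change φ a = 0 at ha0
  obtain ⟨p, b, hb, rfl⟩ := hdecomp a ha
  rw [map_add, map_mul, h1, zero_mul, add_zero] at ha0
  obtain ⟨r, rfl⟩ := dvd_of_aeval_eq_zero (m := m) (Polynomial.monic_X_pow_sub_C _ hh0.ne')
    (irreducible_X_pow_sub_C_X_pow_mul_X (by decide) hh0 h)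
    (by rw [← hφΘ, hΘm, map_mul, h1, zero_mul]) ((hφΘ p).symm.trans ha0)
  refine ⟨_, add_mem (mul_mem (add_mem (mul_mem (pow_mem m1 (h - 1)) me2)
    (mul_mem (pow_mem mu (h - 1)) (pow_mem m1 (q * h)))) (hΘA r)) hb, ?_⟩
  rw [map_mul, hΘm]
  ring

/-- If a ring homomorphism to a domain has kernel generated by `ξ` on a subalgebra `A`, then `ξ` is
prime in `A`. -/
theorem prime_of_ker_eq {S D : Type*} [CommRing S] [Algebra F S] [CommRing D] [IsDomain D]
    {A : Subalgebra F S} {ξ : S} (hξ : ξ ∈ A) (hξ0 : ξ ≠ 0) (φ : S →+* D) (h1 : φ ξ = 0)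
    (hφ : ∀ a ∈ A, φ a = 0 → ∃ b ∈ A, a = ξ * b) : Prime (⟨ξ, hξ⟩ : A) := by
  refine ⟨fun h => hξ0 (congrArg Subtype.val h), fun h => ?_, fun a b hab => ?_⟩
  · have := (h.map A.val).map φ
    change IsUnit (φ ξ) at this
    rw [h1] at this
    exact not_isUnit_zero this
  · have hdvd : ∀ c : A, φ c = 0 → (⟨ξ, hξ⟩ : A) ∣ c := fun c hc => by
      obtain ⟨d, hd, hcd⟩ := hφ c c.2 hc
      exact ⟨⟨d, hd⟩, Subtype.ext hcd⟩
    obtain ⟨c, hc⟩ := hab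
    have : φ a * φ b = 0 := by
      rw [← map_mul, show (a * b : S) = ξ * c from congrArg Subtype.val hc, map_mul, h1, zero_mul]
    exact (mul_eq_zero.1 this).imp (hdvd a) (hdvd b)

theorem mem_of_pow_mul_mem {S D : Type*} [CommRing S] [IsDomain S] [Algebra F S] [CommRing D]
    {A : Subalgebra F S} {ξ : S} (hξ0 : ξ ≠ 0) (φ : S →+* D) (h1 : φ ξ = 0)
    (hφ : ∀ a ∈ A, φ a = 0 → ∃ b ∈ A, a = ξ * b) {f : S} (n : ℕ) (hf : ξ ^ n * f ∈ A) :
    f ∈ A := by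
  induction n with
  | zero => simpa using hf
  | succ n ih =>
    obtain ⟨b, hb, h⟩ := hφ _ hf (by rw [pow_succ', mul_assoc, map_mul, h1, zero_mul])
    rw [pow_succ', mul_assoc] at h
    exact ih (mul_left_cancel₀ hξ0 h ▸ hb)

end

/-- For `q = 2^s > 2`: the ring of invariants of `O_5(F_q)` is the subalgebra
`A` generated by `{ξ_0, ξ_1, ξ_2, ξ_3, e_1, e_2}`; moreover
`A[ξ_1⁻¹] = F_q[ξ_0,ξ_1,ξ_2,ξ_3,e_1][ξ_1⁻¹]` and `ξ_1` is prime in `A`. -/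
theorem stmt_16 {F : Type*} [Field F] [Fintype F] (s q : ℕ) (hs : 2 ≤ s)
    (hq : q = 2 ^ s) (h2 : 2 < q) (hF : Fintype.card F = q)
    (b1 b2 : MvPolynomial OIdx2 F)
    (hb1 : b1 ^ 2 = (dickP F).coeff (q ^ 3)
      + u2 q F ^ (q - 2) * (xiG q F 1 * xiG q F 2 + xiB F * xiG q F 1 ^ q))
    (hb2 : b2 ^ 2 = (dickP F).coeff (q ^ 2)
      + u2 q F ^ (q - 2) * (xiG q F 1 * xiG q F 3 + xiB F * xiG q F 2 ^ q))
    (e1 e2 : MvPolynomial OIdx2 F)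
    (he1 : e1 = u2 q F ^ (2 ^ (s - 1) - 1) * xiG q F 1 ^ 2 ^ (s - 1) * X none + b1)
    (he2 : e2 = u2 q F ^ (2 ^ (s - 1) - 1) * xiG q F 2 ^ 2 ^ (s - 1) * X none + b2)
    (A : Subalgebra F (MvPolynomial OIdx2 F))
    (hA : A = Algebra.adjoin F {xiZ F, xiG q F 1, xiG q F 2, xiG q F 3, e1, e2}) :
    (∀ f : MvPolynomial OIdx2 F,
      (∀ g : (OIdx2 → F) ≃ₗ[F] (OIdx2 → F),
        act g (xiZ F) = xiZ F → act g f = f) ↔ f ∈ A) ∧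
    (Algebra.adjoin F {xiZ F, xiG q F 1, xiG q F 2, xiG q F 3, e1} ≤ A ∧
      ∀ f ∈ A, ∃ n : ℕ, xiG q F 1 ^ n * f ∈
        Algebra.adjoin F {xiZ F, xiG q F 1, xiG q F 2, xiG q F 3, e1}) ∧
    (∀ h : xiG q F 1 ∈ A, Prime (⟨xiG q F 1, h⟩ : A)) := by
  have hq4 : 4 ≤ q := by rw [hq]; exact Nat.pow_le_pow_right (n := 2) two_pos hs
  have hh : q = 2 * 2 ^ (s - 1) := by rw [hq, ← pow_succ']; congr 1; omega
  have : CharP F 2 := charP_of_card_eq_prime_pow (hF.trans hq)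
  have hξ := xiG_one_ne_zero (F := F) (q := q) (by omega)
  have he1' := e_sq hh hb1 he1
  have he2' := e_sq hh hb2 he2
  obtain ⟨D, _, φ, h1, hφ⟩ := exists_algHom_ker_eq hs hq hh hF he1' he2'
  rw [← hA] at hφ
  have hBA : Algebra.adjoin F {xiZ F, xiG q F 1, xiG q F 2, xiG q F 3, e1} ≤ A := by
    rw [hA]
    refine Algebra.adjoin_mono fun a ha => ?_
    simp only [Set.mem_insert_iff, Set.mem_singleton_iff] at ha ⊢
    exact ha.imp_right <| .imp_right <| .imp_right <| .imp_right .inl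
  have hloc := fun f hf => exists_xiG_pow_mul_mem (f := f) hs hq hF (aeval_elim_eq_of_sq hb1)
    he1 he1' hf
  have hinv : ∀ f ∈ A, ∀ g : (OIdx2 → F) ≃ₗ[F] (OIdx2 → F),
      act g (xiZ F) = xiZ F → act g f = f := by
    intro f hf g hg
    have hξg := act_xiG g hq hF hg
    have hu := act_u2 g hq hF hg
    obtain ⟨hd3, hd2⟩ := act_dickP_coeff g hs hq hF hg
    rw [hA] at hf
    refine act_eq_of_mem_adjoin g (fun a ha => ?_) hf
    simp only [Set.mem_insert_iff, Set.mem_singleton_iff] at ha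
    rcases ha with h | h | h | h | h | h <;> rw [h]
    · exact hg
    · exact hξg 1
    · exact hξg 2
    · exact hξg 3
    · refine act_eq_of_sq g ?_
      rw [he1']
      simp only [map_add, map_mul, map_pow, hξg, hu, hd3, hg]
    · refine act_eq_of_sq g ?_
      rw [he2']
      simp only [map_add, map_mul, map_pow, hξg, hu, hd2, hg]
  refine ⟨fun f => ⟨fun hf => ?_, hinv f⟩, ⟨hBA, fun f hf => hloc f (hinv f hf)⟩,
    fun h => prime_of_ker_eq h hξ φ h1 hφ⟩
  obtain ⟨n, hn⟩ := hloc f hf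
  exact mem_of_pow_mul_mem hξ φ h1 hφ n (hBA hn)
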